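/- (Moment estimate for the local time in Gram-determinant form.) Let d ≥ 1 be an integer with αd < 1 + N and let T be a compact interval in (0, ∞) × ℝ^N. Then there exist a constant C < ∞ and r₀ > 0 such that for every compact subinterval I ⊆ T all of whose side lengths are ≤ r₀ and every integer n ≥ 2: ∫_{Iⁿ} [ det Γ(z¹, …, zⁿ) ]^{−d/2} dz¹ ⋯ dzⁿ ≤ Cⁿ (n!)^{αd} [λ_{1+N}(I)]^{n(1 − αd/(1+N))}, where Γ(z¹, …, zⁿ) is the n × n real symmetric matrix with entries Γ_{ij} = Re ∫_ℝ ∫_{ℝ^N} 𝒢_{z^i}(τ, ξ) · conj(𝒢_{z^j}(τ, ξ)) |τ|^{1−2H} h_β(ξ) dξ dτ (this matrix is positive definite for Lebesgue-a.e. (z¹, …, zⁿ) ∈ Iⁿ, and [det Γ]^{−d/2} is interpreted as +∞ when det Γ = 0). Consequently the n-th moment E[L(v, I)ⁿ] of the local time of the solution u is bounded by Cⁿ (n!)^{αd} [λ_{1+N}(I)]^{n(1 − αd/(1+N))} uniformly in the level v ∈ ℝ^d. -/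

import Mathlib

open MeasureTheory Set
open scoped ENNReal

/-- The time–space Fourier transform `𝒢_{t,x}(τ, ξ)` of the wave kernel
`g_{t,x}(s, y) = G(t − s, x − y) 1_{[0,t]}(s)`. -/
noncomputable def Gker (N : ℕ) (t : ℝ) (x : EuclideanSpace ℝ (Fin N)) (τ : ℝ)
    (ξ : EuclideanSpace ℝ (Fin N)) : ℂ :=
  (Complex.exp (-Complex.I * ((inner ℝ x ξ : ℝ) : ℂ)) / (2 * (‖ξ‖ : ℂ))) *
    ((Complex.exp (-Complex.I * (t : ℂ) * (τ : ℂ)) -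
        Complex.exp (Complex.I * (t : ℂ) * (‖ξ‖ : ℂ))) / ((τ : ℂ) + (‖ξ‖ : ℂ)) -
      (Complex.exp (-Complex.I * (t : ℂ) * (τ : ℂ)) -
        Complex.exp (-Complex.I * (t : ℂ) * (‖ξ‖ : ℂ))) / ((τ : ℂ) - (‖ξ‖ : ℂ)))

/-- The covariance matrix `Γ(z¹, …, zⁿ)` of `(u₁(z¹), …, u₁(zⁿ))` (up to a positive
constant), with entries
`Γ_{ij} = Re ∫_ℝ ∫_{ℝ^N} 𝒢_{z^i}(τ,ξ) conj(𝒢_{z^j}(τ,ξ)) |τ|^{1−2H} h_β(ξ) dξ dτ`. -/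
noncomputable def gramMat (N : ℕ) (H : ℝ) (hfun : EuclideanSpace ℝ (Fin N) → ℝ) {n : ℕ}
    (z : Fin n → ℝ × EuclideanSpace ℝ (Fin N)) : Matrix (Fin n) (Fin n) ℝ :=
  Matrix.of fun i j =>
    (∫ τ : ℝ, ∫ ξ : EuclideanSpace ℝ (Fin N),
      Gker N (z i).1 (z i).2 τ ξ * (starRingEnd ℂ) (Gker N (z j).1 (z j).2 τ ξ) *
        ((|τ| ^ (1 - 2 * H) * hfun ξ : ℝ) : ℂ)).re

/-- `α = (2H + 1 − N + β)/2`. -/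
noncomputable def alphaExp (N : ℕ) (H β : ℝ) : ℝ := (2 * H + 1 - N + β) / 2

open scoped SchwartzMap


/-- one dimensional wave kernel transform -/
noncomputable def kk (t τ u : ℝ) : ℂ :=
  ∫ s in (0:ℝ)..t, ((Real.sin ((t - s) * u) / u : ℝ) : ℂ) * Complex.exp (-Complex.I * s * τ)

lemma kk_neg (t τ u : ℝ) : kk t τ (-u) = kk t τ u := by
  unfold kk
  congr 1; ext s
  congr 2
  rw [mul_neg, Real.sin_neg, neg_div_neg_eq]

lemma kk_abs (t τ u : ℝ) : kk t τ |u| = kk t τ u := by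
  rcases abs_choice u with h | h <;> rw [h]
  exact kk_neg t τ u

/-- elementary integral -/
lemma int_exp_aux (t a : ℝ) (ha : a ≠ 0) :
    ∫ s in (0:ℝ)..t, Complex.exp (-Complex.I * s * a) =
      Complex.I * (Complex.exp (-Complex.I * t * a) - 1) / a := by
  have h : (-Complex.I * a) ≠ 0 := by simp [ha]
  have := integral_exp_mul_complex (a := 0) (b := t) h
  have e : ∀ s : ℝ, Complex.exp (-Complex.I * s * a) = Complex.exp (-Complex.I * a * s) := by
    intro s; congr 1; ring
  simp_rw [e]
  rw [this]
  have ha' : (a : ℂ) ≠ 0 := by exact_mod_cast ha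
  simp only [Complex.ofReal_zero, mul_zero, Complex.exp_zero]
  field_simp
  simp [Complex.I_sq]

lemma kk_eq (t τ u : ℝ) (hu : u ≠ 0) (h1 : τ + u ≠ 0) (h2 : τ - u ≠ 0) :
    kk t τ u = (1 / (2 * (u:ℂ))) *
    ((Complex.exp (-Complex.I * (t : ℂ) * (τ : ℂ)) -
        Complex.exp (Complex.I * (t : ℂ) * (u : ℂ))) / ((τ : ℂ) + (u : ℂ)) -
      (Complex.exp (-Complex.I * (t : ℂ) * (τ : ℂ)) -
        Complex.exp (-Complex.I * (t : ℂ) * (u : ℂ))) / ((τ : ℂ) - (u : ℂ))) := by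
  have e : ∀ s : ℝ, ((Real.sin ((t - s) * u) / u : ℝ) : ℂ) * Complex.exp (-Complex.I * s * τ) =
      (Complex.I / (2 * u)) * Complex.exp (-Complex.I * t * u) *
        Complex.exp (-Complex.I * s * ((τ - u : ℝ) : ℂ)) -
      (Complex.I / (2 * u)) * Complex.exp (Complex.I * t * u) *
        Complex.exp (-Complex.I * s * ((τ + u : ℝ) : ℂ)) := by
    intro s
    push_cast
    rw [Complex.sin]
    rw [mul_assoc (Complex.I / (2 * (u:ℂ))), ← Complex.exp_add,
      mul_assoc (Complex.I / (2 * (u:ℂ))), ← Complex.exp_add]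
    rw [div_mul_eq_mul_div, div_mul_eq_mul_div]
    rw [mul_right_comm, sub_mul, ← Complex.exp_add, ← Complex.exp_add]
    rw [show -((↑t - ↑s) * (u:ℂ)) * Complex.I + -Complex.I * ↑s * ↑τ =
      -Complex.I * ↑t * ↑u + -Complex.I * ↑s * (↑τ - ↑u) by ring,
      show ((↑t - ↑s) * (u:ℂ)) * Complex.I + -Complex.I * ↑s * ↑τ =
      Complex.I * ↑t * ↑u + -Complex.I * ↑s * (↑τ + ↑u) by ring]
    have : (u:ℂ) ≠ 0 := by exact_mod_cast hu
    field_simp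
  unfold kk
  simp_rw [e]
  rw [intervalIntegral.integral_sub (by apply Continuous.intervalIntegrable; fun_prop)
    (by apply Continuous.intervalIntegrable; fun_prop),
    intervalIntegral.integral_const_mul, intervalIntegral.integral_const_mul,
    int_exp_aux _ _ h1, int_exp_aux _ _ h2]
  have hu' : (u:ℂ) ≠ 0 := by exact_mod_cast hu
  have h1' : (τ:ℂ) + u ≠ 0 := by exact_mod_cast h1
  have h2' : (τ:ℂ) - u ≠ 0 := by exact_mod_cast h2
  have E1 : Complex.exp (-Complex.I * t * τ) =
    Complex.exp (-Complex.I * t * u) * Complex.exp (-Complex.I * t * (τ - u)) := by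
    rw [← Complex.exp_add]; congr 1; ring
  have E2 : Complex.exp (-Complex.I * t * τ) =
    Complex.exp (Complex.I * t * u) * Complex.exp (-Complex.I * t * (τ + u)) := by
    rw [← Complex.exp_add]; congr 1; ring
  push_cast
  have i2 : Complex.I * Complex.I = -1 := Complex.I_mul_I
  have A : Complex.I / (2 * (u:ℂ)) * Complex.exp (-Complex.I * t * u) *
      (Complex.I * (Complex.exp (-Complex.I * t * (τ - u)) - 1) / (τ - u)) =
      -(1 / (2 * (u:ℂ))) * ((Complex.exp (-Complex.I * t * τ) - Complex.exp (-Complex.I * t * u)) / (τ - u)) := by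
    rw [E1]; linear_combination (1 / (2 * (u:ℂ))) * ((Complex.exp (-Complex.I * t * u) * Complex.exp (-Complex.I * t * (τ - u)) - Complex.exp (-Complex.I * t * u)) / (τ - u)) * i2
  have B : Complex.I / (2 * (u:ℂ)) * Complex.exp (Complex.I * t * u) *
      (Complex.I * (Complex.exp (-Complex.I * t * (τ + u)) - 1) / (τ + u)) =
      -(1 / (2 * (u:ℂ))) * ((Complex.exp (-Complex.I * t * τ) - Complex.exp (Complex.I * t * u)) / (τ + u)) := by
    rw [E2]; linear_combination (1 / (2 * (u:ℂ))) * ((Complex.exp (Complex.I * t * u) * Complex.exp (-Complex.I * t * (τ + u)) - Complex.exp (Complex.I * t * u)) / (τ + u)) * i2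
  rw [A, B]; ring

lemma Gker_eq_kk {N : ℕ} (t : ℝ) (x : EuclideanSpace ℝ (Fin N)) (τ : ℝ)
    (ξ : EuclideanSpace ℝ (Fin N)) (hu : ‖ξ‖ ≠ 0) (h1 : τ + ‖ξ‖ ≠ 0) (h2 : τ - ‖ξ‖ ≠ 0) :
    Gker N t x τ ξ = Complex.exp (-Complex.I * ((inner ℝ x ξ : ℝ) : ℂ)) * kk t τ ‖ξ‖ := by
  rw [kk_eq t τ _ hu h1 h2, Gker]; ring

/-- bound (i) -/
lemma norm_exp_aux (s τ : ℝ) : ‖Complex.exp (-Complex.I * s * τ)‖ = 1 := by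
  have : -Complex.I * s * τ = ((-(s * τ) : ℝ) : ℂ) * Complex.I := by push_cast; ring
  rw [this, Complex.norm_exp_ofReal_mul_I]

lemma abs_sin_div_le (b u : ℝ) (hb : 0 ≤ b) : |Real.sin (b * u) / u| ≤ b := by
  rcases eq_or_ne u 0 with rfl | hu
  · simpa using hb
  · rw [abs_div, div_le_iff₀ (abs_pos.mpr hu)]
    have := Real.abs_sin_le_abs (x := b * u)
    rwa [abs_mul, abs_of_nonneg hb] at this

lemma norm_kk_le (t τ u : ℝ) (ht : 0 ≤ t) : ‖kk t τ u‖ ≤ t ^ 2 := by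
  unfold kk
  have := intervalIntegral.norm_integral_le_of_norm_le_const (a := 0) (b := t) (C := t)
    (f := fun s : ℝ => ((Real.sin ((t - s) * u) / u : ℝ) : ℂ) * Complex.exp (-Complex.I * s * τ)) ?_
  · simpa [abs_of_nonneg ht, sq] using this
  · intro s hs
    rw [uIoc_of_le ht] at hs
    rw [norm_mul, norm_exp_aux, mul_one, Complex.norm_real, Real.norm_eq_abs]
    exact (abs_sin_div_le _ _ (by linarith [hs.2])).trans (by linarith [hs.1])

/-- bound (ii) -/
lemma norm_kk_le_two (t τ u : ℝ) (ht : 0 ≤ t) (hu : u ≠ 0) (h1 : τ + u ≠ 0) (h2 : τ - u ≠ 0) :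
    ‖kk t τ u‖ ≤ (1 / (2 * |u|)) * (2 / |τ + u| + 2 / |τ - u|) := by
  rw [kk_eq t τ u hu h1 h2, norm_mul]
  have a : ‖(1 / (2 * (u:ℂ)))‖ = 1 / (2 * |u|) := by simp
  rw [a]
  gcongr
  have n1 : ∀ x y : ℝ, ‖Complex.exp (-Complex.I * x * y)‖ = 1 := norm_exp_aux
  have n2 : ‖Complex.exp (Complex.I * t * u)‖ = 1 := by
    have := n1 (-t) u
    rwa [Complex.ofReal_neg, neg_mul_neg] at this
  refine (norm_sub_le _ _).trans ?_
  have c1 : ‖(τ:ℂ) + u‖ = |τ + u| := by rw [← Complex.ofReal_add, Complex.norm_real]; rfl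
  have c2 : ‖(τ:ℂ) - u‖ = |τ - u| := by rw [← Complex.ofReal_sub, Complex.norm_real]; rfl
  rw [norm_div, norm_div, c1, c2]
  gcongr
  · exact (norm_sub_le _ _).trans (by rw [n1, n2]; norm_num)
  · exact (norm_sub_le _ _).trans (by rw [n1, n1]; norm_num)

lemma norm_kk_mul_le (t τ u : ℝ) (ht : 0 ≤ t) : ‖kk t τ u‖ * |u| ≤ t := by
  rcases eq_or_ne u 0 with rfl | hu
  · simpa using ht
  unfold kk
  have := intervalIntegral.norm_integral_le_of_norm_le_const (a := 0) (b := t) (C := 1 / |u|)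
    (f := fun s : ℝ => ((Real.sin ((t - s) * u) / u : ℝ) : ℂ) * Complex.exp (-Complex.I * s * τ)) ?_
  · rw [sub_zero, abs_of_nonneg ht] at this
    have hu' := abs_pos.mpr hu
    calc _ ≤ (1 / |u| * t) * |u| := by gcongr
      _ = t := by field_simp
  · intro s hs
    rw [norm_mul, norm_exp_aux, mul_one, Complex.norm_real, Real.norm_eq_abs, abs_div]
    gcongr
    exact Real.abs_sin_le_one _


/-- bound (iii), integration by parts -/
lemma norm_kk_mul_tau_le (t τ u : ℝ) (ht : 0 ≤ t) (hu : u ≠ 0) : ‖kk t τ u‖ * |τ| ≤ 2 * t := by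
  rcases eq_or_ne τ 0 with rfl | hτ
  · simpa using ht
  have hτ' : (τ:ℂ) ≠ 0 := by exact_mod_cast hτ
  have huC : (u:ℂ) ≠ 0 := by exact_mod_cast hu
  have key := intervalIntegral.integral_mul_deriv_eq_deriv_mul (a := 0) (b := t)
    (u := fun s : ℝ => ((Real.sin ((t - s) * u) / u : ℝ) : ℂ))
    (u' := fun s : ℝ => ((-Real.cos ((t - s) * u) : ℝ) : ℂ))
    (v := fun s : ℝ => (Complex.I / τ) * Complex.exp (-Complex.I * s * τ))
    (v' := fun s : ℝ => Complex.exp (-Complex.I * s * τ)) ?_ ?_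
    (by apply Continuous.intervalIntegrable; fun_prop)
    (by apply Continuous.intervalIntegrable; fun_prop)
  · have hk : kk t τ u = -(((Real.sin ((t - 0) * u) / u : ℝ) : ℂ) * ((Complex.I / τ) * Complex.exp (-Complex.I * (0:ℝ) * τ)))
        - ∫ s in (0:ℝ)..t, ((-Real.cos ((t - s) * u) : ℝ) : ℂ) * ((Complex.I / τ) * Complex.exp (-Complex.I * s * τ)) := by
      unfold kk
      rw [key]; simp
    have hτa := abs_pos.mpr hτ
    have nI : ‖Complex.I / (τ:ℂ)‖ = 1 / |τ| := by simp
    have b1 : ‖((Real.sin ((t - 0) * u) / u : ℝ) : ℂ) * ((Complex.I / τ) * Complex.exp (-Complex.I * (0:ℝ) * τ))‖ ≤ t * (1 / |τ|) := by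
      rw [norm_mul, norm_mul, norm_exp_aux, mul_one, nI, Complex.norm_real, Real.norm_eq_abs]
      gcongr
      rw [sub_zero]; exact abs_sin_div_le _ _ ht
    have b2 := intervalIntegral.norm_integral_le_of_norm_le_const (a := 0) (b := t) (C := 1 / |τ|)
      (f := fun s : ℝ => ((-Real.cos ((t - s) * u) : ℝ) : ℂ) * ((Complex.I / τ) * Complex.exp (-Complex.I * s * τ))) (by
        intro s hs
        rw [norm_mul, norm_mul, norm_exp_aux, mul_one, nI, Complex.norm_real, Real.norm_eq_abs, abs_neg]
        calc _ ≤ 1 * (1 / |τ|) := by gcongr; exact Real.abs_cos_le_one _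
          _ = _ := one_mul _)
    rw [sub_zero, abs_of_nonneg ht] at b2
    have : ‖kk t τ u‖ ≤ 2 * t * (1 / |τ|) := by
      rw [hk]
      refine (norm_sub_le _ _).trans ?_
      rw [norm_neg]
      linarith
    calc _ ≤ 2 * t * (1 / |τ|) * |τ| := by gcongr
      _ = 2 * t := by field_simp
  · intro s _
    apply HasDerivAt.ofReal_comp
    have h1 : HasDerivAt (fun s : ℝ => (t - s) * u) (-1 * u) s := by
      simpa using ((hasDerivAt_const s t).sub (hasDerivAt_id s)).mul_const u
    have h2 := (h1.sin).div_const u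
    have h3 : Real.cos ((t - s) * u) * (-1 * u) / u = -Real.cos ((t - s) * u) := by
      field_simp
    rw [h3] at h2
    exact h2
  · intro s _
    have h1 : HasDerivAt (fun s : ℝ => -Complex.I * s * τ) (-Complex.I * 1 * τ) s := by
      have := (Complex.ofRealCLM.hasDerivAt (x := s))
      simpa using (this.const_mul (-Complex.I)).mul_const (τ:ℂ)
    have h2 := (h1.cexp).const_mul (Complex.I / (τ:ℂ))
    convert h2 using 1
    field_simp
    simp [Complex.I_sq]

lemma norm_kk_sq_le_small (t τ u : ℝ) (ht : 0 ≤ t) (hu : u ≠ 0) :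
    ‖kk t τ u‖ ^ 2 ≤ (t ^ 4 + 4 * t ^ 2) * (1 + τ ^ 2)⁻¹ := by
  rw [← div_eq_mul_inv, le_div_iff₀ (by positivity)]
  have h1 := norm_kk_le t τ u ht
  have h2 := norm_kk_mul_tau_le t τ u ht hu
  have h1' : ‖kk t τ u‖ ^ 2 ≤ (t ^ 2) ^ 2 := by gcongr
  have h2' : (‖kk t τ u‖ * |τ|) ^ 2 ≤ (2 * t) ^ 2 := by gcongr
  rw [mul_pow, sq_abs] at h2'
  nlinarith

lemma quot_bound (t a b : ℝ) (ht : 0 ≤ t) (hab : a + b ≠ 0) :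
    ‖(Complex.exp (-Complex.I * t * a) - Complex.exp (Complex.I * t * b)) / ((a:ℂ) + b)‖ ^ 2 ≤
      (t ^ 2 + 4) * (1 + (a + b) ^ 2)⁻¹ := by
  have e : Complex.exp (-Complex.I * t * a) - Complex.exp (Complex.I * t * b) =
    -Complex.exp (-Complex.I * t * a) * (Complex.exp (Complex.I * ((t * (a + b) : ℝ) : ℂ)) - 1) := by
    have h : Complex.exp (-Complex.I * t * a) * Complex.exp (Complex.I * ((t * (a + b) : ℝ) : ℂ)) =
        Complex.exp (Complex.I * t * b) := by
      rw [← Complex.exp_add]; congr 1; push_cast; ring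
    rw [← h]; ring
  have c1 : ‖(a:ℂ) + b‖ = |a + b| := by rw [← Complex.ofReal_add, Complex.norm_real]; rfl
  rw [norm_div, c1, e, norm_mul, norm_neg, norm_exp_aux, one_mul]
  set D := ‖Complex.exp (Complex.I * ((t * (a + b) : ℝ) : ℂ)) - 1‖
  have d1 : D ≤ t * |a + b| := by
    have := Real.norm_exp_I_mul_ofReal_sub_one_le (x := t * (a + b))
    rwa [Real.norm_eq_abs, abs_mul, abs_of_nonneg ht] at this
  have d2 : D ≤ 2 := by
    refine (norm_sub_le _ _).trans ?_
    have : ‖Complex.exp (Complex.I * ((t * (a + b) : ℝ) : ℂ))‖ = 1 := by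
      rw [mul_comm, Complex.norm_exp_ofReal_mul_I]
    rw [this]; norm_num
  have d0 : 0 ≤ D := norm_nonneg _
  have hp := abs_pos.mpr hab
  rw [← div_eq_mul_inv, le_div_iff₀ (by positivity), div_pow, sq_abs, div_mul_eq_mul_div,
    div_le_iff₀ (by positivity)]
  have d1' : D ^ 2 ≤ (t * |a + b|) ^ 2 := by gcongr
  have d2' : D ^ 2 ≤ 2 ^ 2 := by gcongr
  rw [mul_pow, sq_abs] at d1'
  nlinarith [mul_le_mul_of_nonneg_right d2' (sq_nonneg (a + b))]

lemma norm_kk_sq_le_large (t τ u : ℝ) (ht : 0 ≤ t) (hu : u ≠ 0) (h1 : τ + u ≠ 0) (h2 : τ - u ≠ 0) :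
    ‖kk t τ u‖ ^ 2 ≤ (t ^ 2 + 4) * (u ^ 2)⁻¹ * ((1 + (τ + u) ^ 2)⁻¹ + (1 + (τ - u) ^ 2)⁻¹) := by
  rw [kk_eq t τ u hu h1 h2, norm_mul, mul_pow]
  have a : ‖(1 / (2 * (u:ℂ)))‖ ^ 2 = (1 / 4) * (u ^ 2)⁻¹ := by
    rw [show ‖(1 / (2 * (u:ℂ)))‖ = 1 / (2 * |u|) by simp, div_pow, mul_pow, sq_abs]
    field_simp; norm_num
  have q1 := quot_bound t τ u ht h1
  have q2 := quot_bound t τ (-u) ht (by rwa [← sub_eq_add_neg])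
  rw [Complex.ofReal_neg, ← sub_eq_add_neg, ← sub_eq_add_neg,
    show Complex.I * (t:ℂ) * -(u:ℂ) = -Complex.I * t * u by ring] at q2
  set A := (Complex.exp (-Complex.I * (t : ℂ) * (τ : ℂ)) -
        Complex.exp (Complex.I * (t : ℂ) * (u : ℂ))) / ((τ : ℂ) + (u : ℂ))
  set B := (Complex.exp (-Complex.I * (t : ℂ) * (τ : ℂ)) -
        Complex.exp (-Complex.I * (t : ℂ) * (u : ℂ))) / ((τ : ℂ) - (u : ℂ))
  have hs : ‖A - B‖ ^ 2 ≤ 2 * (‖A‖ ^ 2 + ‖B‖ ^ 2) := by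
    have : ‖A - B‖ ^ 2 ≤ (‖A‖ + ‖B‖) ^ 2 := by gcongr; exact norm_sub_le _ _
    nlinarith [sq_nonneg (‖A‖ - ‖B‖)]
  rw [a]
  have hu2 : 0 ≤ (u ^ 2)⁻¹ := by positivity
  calc _ ≤ (1 / 4) * (u ^ 2)⁻¹ * (4 * ((t ^ 2 + 4) * (1 + (τ + u) ^ 2)⁻¹ + (t ^ 2 + 4) * (1 + (τ - u) ^ 2)⁻¹)) := by
        gcongr
        have : 0 ≤ ‖A‖^2 + ‖B‖^2 := by positivity
        linarith
    _ = _ := by ring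


lemma lint_norm_rpow_ball {E : Type*} [NormedAddCommGroup E] [NormedSpace ℝ E] [MeasurableSpace E]
    [BorelSpace E] [FiniteDimensional ℝ E] [Nontrivial E] (μ : Measure E) [μ.IsAddHaarMeasure]
    (s R : ℝ) (hR : 0 < R) (hs : s < Module.finrank ℝ E) :
    ∫⁻ x in Metric.ball (0:E) R, ENNReal.ofReal (‖x‖ ^ (-s)) ∂μ < ∞ := by
  have h : IntegrableOn (fun x : E => ‖x‖ ^ (-s)) (Metric.ball (0:E) R) μ := by
    rw [integrableOn_fun_norm_addHaar μ (f := fun r : ℝ => r ^ (-s))]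
    have h1 : IntegrableOn (fun y : ℝ => y ^ ((Module.finrank ℝ E : ℝ) - 1 - s)) (Ioo 0 R) := by
      rw [intervalIntegral.integrableOn_Ioo_rpow_iff hR]; linarith
    refine h1.congr_fun ?_ measurableSet_Ioo
    intro y hy
    have hd : 1 ≤ Module.finrank ℝ E := Module.finrank_pos
    simp only [smul_eq_mul]
    rw [← Real.rpow_natCast, ← Real.rpow_add hy.1]
    congr 1
    push_cast [hd]; ring
  exact Integrable.lintegral_lt_top h

lemma lint_abs_rpow (γ : ℝ) (hγ : γ < 1) :
    ∫⁻ τ in Metric.ball (0:ℝ) 2, ENNReal.ofReal (|τ| ^ (-γ)) < ∞ := by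
  simpa using lint_norm_rpow_ball (volume : Measure ℝ) γ 2 (by norm_num) (by simpa using hγ)

lemma lint_japanese (γ : ℝ) (hγ : γ < 1) :
    ∫⁻ τ : ℝ, ENNReal.ofReal ((1 + τ ^ 2) ^ (-(2 - γ) / 2)) < ∞ := by
  have := (integrable_rpow_neg_one_add_norm_sq (E := ℝ) (μ := volume) (r := 2 - γ)
    (by simp; linarith)).lintegral_lt_top
  simpa using this

lemma tau_pt_small (γ τ : ℝ) (hγ0 : 0 ≤ γ) :
    ENNReal.ofReal (|τ| ^ (-γ) * (1 + τ ^ 2)⁻¹) ≤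
      (Metric.ball (0:ℝ) 2).indicator (fun τ => ENNReal.ofReal (|τ| ^ (-γ))) τ +
      ENNReal.ofReal ((1 + τ ^ 2) ^ (-(2 - γ) / 2)) := by
  have hp : (0:ℝ) ≤ |τ| ^ (-γ) := by positivity
  have h1 : (1 + τ ^ 2)⁻¹ ≤ 1 := inv_le_one_of_one_le₀ (by nlinarith [sq_nonneg τ])
  by_cases h : τ ∈ Metric.ball (0:ℝ) 2
  · rw [indicator_of_mem h]
    refine le_add_right (ENNReal.ofReal_le_ofReal ?_)
    exact mul_le_of_le_one_right hp h1
  · rw [indicator_of_notMem h, zero_add]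
    apply ENNReal.ofReal_le_ofReal
    have h2 : 2 ≤ |τ| := by simpa using h
    have h3 : |τ| ^ (-γ) ≤ 1 := Real.rpow_le_one_of_one_le_of_nonpos (by linarith) (by linarith)
    calc _ ≤ 1 * (1 + τ ^ 2)⁻¹ := by gcongr
      _ = (1 + τ ^ 2) ^ (-1 : ℝ) := by rw [one_mul, Real.rpow_neg_one]
      _ ≤ _ := by
        apply Real.rpow_le_rpow_of_exponent_le (by nlinarith [sq_nonneg τ])
        linarith

lemma tau_pt_large (γ τ r : ℝ) (hγ0 : 0 ≤ γ) (hγ : γ < 1) (hτ : τ ≠ 0) (hr : r ≠ 0) :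
    ENNReal.ofReal (|τ| ^ (-γ) * (1 + (τ - r) ^ 2)⁻¹) ≤
      ENNReal.ofReal (|r| ^ (-γ)) * ((Metric.ball (0:ℝ) 2).indicator (fun τ => ENNReal.ofReal (|τ| ^ (-γ))) τ +
      2 * ENNReal.ofReal ((1 + (τ - r) ^ 2) ^ (-(2 - γ) / 2))) := by
  have hτp := abs_pos.mpr hτ
  have hrp := abs_pos.mpr hr
  set A := 1 + (τ - r) ^ 2 with hA
  have hA1 : 1 ≤ A := by nlinarith [sq_nonneg (τ - r)]
  set J := A ^ (-(2 - γ) / 2) with hJ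
  have hJ0 : 0 ≤ J := by positivity
  have hJ1 : J ≤ 1 := Real.rpow_le_one_of_one_le_of_nonpos hA1 (by linarith)
  have hAJ : A⁻¹ ≤ J := by
    rw [← Real.rpow_neg_one]
    exact Real.rpow_le_rpow_of_exponent_le hA1 (by linarith)
  -- |r|^γ ≤ |τ|^γ + A^(γ/2)
  have t1 : |r| ^ γ ≤ |τ| ^ γ + A ^ (γ / 2) := by
    have : |r| ≤ |τ| + |τ - r| := by
      have := abs_sub_abs_le_abs_sub r τ
      rw [abs_sub_comm] at this; linarith
    have h2 : |τ - r| ^ γ ≤ A ^ (γ / 2) := by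
      have : |τ - r| ^ γ = ((τ - r) ^ 2) ^ (γ / 2) := by
        rw [← sq_abs, ← Real.rpow_natCast, ← Real.rpow_mul (abs_nonneg _)]
        congr 1; push_cast; ring
      rw [this]
      apply Real.rpow_le_rpow (sq_nonneg _) (by linarith) (by linarith)
    calc _ ≤ (|τ| + |τ - r|) ^ γ := Real.rpow_le_rpow hrp.le this hγ0
      _ ≤ |τ| ^ γ + |τ - r| ^ γ :=
        Real.rpow_add_le_add_rpow hτp.le (abs_nonneg _) hγ0 hγ.le
      _ ≤ _ := by linarith
  have hAA : A ^ (γ / 2) * A⁻¹ = J := by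
    rw [← Real.rpow_neg_one, ← Real.rpow_add (by linarith)]
    congr 1; ring
  have hτγ : 0 < |τ| ^ γ := by positivity
  have hrγ : 0 < |r| ^ γ := by positivity
  have main : |τ| ^ (-γ) * A⁻¹ ≤ |r| ^ (-γ) * (|τ| ^ (-γ) * J + J) := by
    rw [Real.rpow_neg hτp.le, Real.rpow_neg hrp.le]
    rw [← div_eq_inv_mul, ← div_eq_inv_mul, div_le_div_iff₀ hτγ hrγ]
    have : ((|τ| ^ γ)⁻¹ * J + J) * |τ| ^ γ = J + J * |τ| ^ γ := by field_simp
    rw [this]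
    have hAi : 0 ≤ A⁻¹ := by positivity
    calc A⁻¹ * |r| ^ γ ≤ A⁻¹ * (|τ| ^ γ + A ^ (γ / 2)) := by gcongr
      _ = A⁻¹ * |τ| ^ γ + J := by rw [mul_add, mul_comm _ (A ^ (γ/2)), hAA]
      _ ≤ J * |τ| ^ γ + J := by gcongr
      _ = _ := by ring
  refine (ENNReal.ofReal_le_ofReal main).trans ?_
  rw [ENNReal.ofReal_mul (by positivity)]
  gcongr
  by_cases h : τ ∈ Metric.ball (0:ℝ) 2
  · rw [indicator_of_mem h, ENNReal.ofReal_add (by positivity) hJ0]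
    gcongr
    · exact mul_le_of_le_one_right (by positivity) hJ1
    · exact le_mul_of_one_le_left (by simp) (by norm_num)
  · rw [indicator_of_notMem h, zero_add]
    have h2 : 2 ≤ |τ| := by simpa using h
    have h3 : |τ| ^ (-γ) ≤ 1 := Real.rpow_le_one_of_one_le_of_nonpos (by linarith) (by linarith)
    rw [show (2:ℝ≥0∞) = ENNReal.ofReal 2 by simp, ← ENNReal.ofReal_mul (by norm_num)]
    apply ENNReal.ofReal_le_ofReal
    nlinarith

lemma tau_int (γ : ℝ) (hγ0 : 0 ≤ γ) (hγ : γ < 1) : ∃ C : ℝ≥0∞, C ≠ ∞ ∧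
    (∫⁻ τ : ℝ, ENNReal.ofReal (|τ| ^ (-γ) * (1 + τ ^ 2)⁻¹) ≤ C) ∧
    ∀ r : ℝ, r ≠ 0 → ∫⁻ τ : ℝ, ENNReal.ofReal (|τ| ^ (-γ) * (1 + (τ - r) ^ 2)⁻¹) ≤
      ENNReal.ofReal (|r| ^ (-γ)) * C := by
  refine ⟨(∫⁻ τ in Metric.ball (0:ℝ) 2, ENNReal.ofReal (|τ| ^ (-γ))) +
    2 * ∫⁻ τ : ℝ, ENNReal.ofReal ((1 + τ ^ 2) ^ (-(2 - γ) / 2)), ?_, ?_, ?_⟩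
  · exact ENNReal.add_ne_top.mpr ⟨(lint_abs_rpow γ hγ).ne,
      ENNReal.mul_ne_top (by simp) (lint_japanese γ hγ).ne⟩
  · refine (lintegral_mono (tau_pt_small γ · hγ0)).trans ?_
    rw [lintegral_add_right _ (by fun_prop), lintegral_indicator measurableSet_ball]
    gcongr
    exact le_mul_of_one_le_left (by simp) (by norm_num)
  · intro r hr
    have : ∀ᵐ τ : ℝ, τ ≠ 0 := by simp [ae_iff]
    refine (lintegral_mono_ae (this.mono fun τ hτ => tau_pt_large γ τ r hγ0 hγ hτ hr)).trans ?_
    rw [lintegral_const_mul _ (by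
      refine Measurable.add (Measurable.indicator (by fun_prop) measurableSet_ball) (by fun_prop)),
      lintegral_add_right _ (by fun_prop), lintegral_indicator measurableSet_ball,
      lintegral_const_mul _ (by fun_prop)]
    rw [lintegral_sub_right_eq_self (fun τ : ℝ => ENNReal.ofReal ((1 + τ ^ 2) ^ (-(2 - γ) / 2))) r]


lemma measurable_Gker (N : ℕ) (t : ℝ) (x : EuclideanSpace ℝ (Fin N)) :
    Measurable (fun p : ℝ × EuclideanSpace ℝ (Fin N) => Gker N t x p.1 p.2) := by
  unfold Gker
  fun_prop

lemma norm_Gker_sq {N : ℕ} (t : ℝ) (x : EuclideanSpace ℝ (Fin N)) (τ : ℝ)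
    (ξ : EuclideanSpace ℝ (Fin N)) (hu : ‖ξ‖ ≠ 0) (h1 : τ + ‖ξ‖ ≠ 0) (h2 : τ - ‖ξ‖ ≠ 0) :
    ‖Gker N t x τ ξ‖ = ‖kk t τ ‖ξ‖‖ := by
  have := norm_exp_aux (inner ℝ x ξ) 1
  rw [Complex.ofReal_one, mul_one] at this
  rw [Gker_eq_kk t x τ ξ hu h1 h2, norm_mul, this, one_mul]

lemma G_sq_finite (N : ℕ) (hN : 1 ≤ N) (H β : ℝ) (hH1 : 1 / 2 ≤ H) (hH2 : H < 1)
    (hβN : β < N)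
    (hβlow : (N : ℝ) - 2 * H - 1 < β) (t : ℝ) (ht : 0 ≤ t) (x : EuclideanSpace ℝ (Fin N)) :
    ∫⁻ p : ℝ × EuclideanSpace ℝ (Fin N), ENNReal.ofReal (‖Gker N t x p.1 p.2‖ ^ 2 *
      (|p.1| ^ (1 - 2 * H) * ‖p.2‖ ^ (-β))) < ∞ := by
  have : Nonempty (Fin N) := ⟨⟨0, hN⟩⟩
  have hmeas := measurable_Gker N t x
  obtain ⟨C, hC, hCs, hCl⟩ := tau_int (2 * H - 1) (by linarith) (by linarith)
  rw [show -(2 * H - 1) = 1 - 2 * H by ring] at *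
  rw [Measure.volume_eq_prod, lintegral_prod_symm' _ (by fun_prop)]
  set K₁ := t ^ 4 + 4 * t ^ 2 with hK1
  set K₂ := t ^ 2 + 4 with hK2
  have hK1' : 0 ≤ K₁ := by positivity
  set B := β + 2 + (2 * H - 1) with hB
  have hB0 : 0 < B := by
    have : (1:ℝ) ≤ N := by exact_mod_cast hN
    linarith
  have key : ∀ ξ : EuclideanSpace ℝ (Fin N), ξ ≠ 0 →
      ∫⁻ τ : ℝ, ENNReal.ofReal (‖Gker N t x τ ξ‖ ^ 2 * (|τ| ^ (1 - 2 * H) * ‖ξ‖ ^ (-β))) ≤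
      (Metric.ball (0 : EuclideanSpace ℝ (Fin N)) 2).indicator
        (fun ξ => ENNReal.ofReal (‖ξ‖ ^ (-β))) ξ * (ENNReal.ofReal K₁ * C) +
      ENNReal.ofReal ((1 + ‖ξ‖) ^ (-B)) * (ENNReal.ofReal (K₂ * 2 ^ B) * (2 * C)) := by
    intro ξ hξ
    have hu : 0 < ‖ξ‖ := norm_pos_iff.mpr hξ
    have ae1 : ∀ᵐ τ : ℝ, τ ≠ ‖ξ‖ := by simp [ae_iff]
    have ae2 : ∀ᵐ τ : ℝ, τ ≠ -‖ξ‖ := by simp [ae_iff]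
    by_cases h : ξ ∈ Metric.ball (0 : EuclideanSpace ℝ (Fin N)) 2
    · rw [indicator_of_mem h]
      refine le_add_right ?_
      calc _ ≤ ∫⁻ τ : ℝ, ENNReal.ofReal (K₁ * ‖ξ‖ ^ (-β)) * ENNReal.ofReal (|τ| ^ (1 - 2 * H) * (1 + τ ^ 2)⁻¹) := by
            apply lintegral_mono_ae
            filter_upwards [ae1, ae2] with τ h1 h2
            rw [norm_Gker_sq t x τ ξ hu.ne' (by intro h; apply h2; linarith) (by intro h; apply h1; linarith),
              ← ENNReal.ofReal_mul (by positivity)]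
            apply ENNReal.ofReal_le_ofReal
            calc _ ≤ (K₁ * (1 + τ ^ 2)⁻¹) * (|τ| ^ (1 - 2 * H) * ‖ξ‖ ^ (-β)) := by
                  gcongr; exact norm_kk_sq_le_small t τ _ ht hu.ne'
              _ = _ := by ring
        _ ≤ ENNReal.ofReal (K₁ * ‖ξ‖ ^ (-β)) * C := by
            rw [lintegral_const_mul _ (by fun_prop)]; gcongr
        _ = _ := by rw [mul_comm K₁, ENNReal.ofReal_mul (by positivity), mul_assoc]
    · rw [indicator_of_notMem h, zero_mul, zero_add]
      have h2u : 2 ≤ ‖ξ‖ := by simpa using h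
      have cl1 := hCl ‖ξ‖ hu.ne'
      have cl2 := hCl (-‖ξ‖) (by simpa using hξ)
      simp only [sub_neg_eq_add, abs_neg, abs_norm] at cl1 cl2
      calc _ ≤ ∫⁻ τ : ℝ, ENNReal.ofReal (K₂ * (‖ξ‖ ^ 2)⁻¹ * ‖ξ‖ ^ (-β)) * (ENNReal.ofReal (|τ| ^ (1 - 2 * H) * (1 + (τ + ‖ξ‖) ^ 2)⁻¹) + ENNReal.ofReal (|τ| ^ (1 - 2 * H) * (1 + (τ - ‖ξ‖) ^ 2)⁻¹)) := by
            apply lintegral_mono_ae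
            filter_upwards [ae1, ae2] with τ h1 h2
            have h1' : τ - ‖ξ‖ ≠ 0 := by intro h; apply h1; linarith
            have h2' : τ + ‖ξ‖ ≠ 0 := by intro h; apply h2; linarith
            rw [norm_Gker_sq t x τ ξ hu.ne' h2' h1', ← ENNReal.ofReal_add (by positivity) (by positivity),
              ← ENNReal.ofReal_mul (by positivity)]
            apply ENNReal.ofReal_le_ofReal
            calc _ ≤ (K₂ * (‖ξ‖ ^ 2)⁻¹ * ((1 + (τ + ‖ξ‖) ^ 2)⁻¹ + (1 + (τ - ‖ξ‖) ^ 2)⁻¹)) * (|τ| ^ (1 - 2 * H) * ‖ξ‖ ^ (-β)) := by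
                  gcongr; exact norm_kk_sq_le_large t τ _ ht hu.ne' h2' h1'
              _ = _ := by ring
        _ ≤ ENNReal.ofReal (K₂ * (‖ξ‖ ^ 2)⁻¹ * ‖ξ‖ ^ (-β)) * (ENNReal.ofReal (‖ξ‖ ^ (1 - 2 * H)) * C + ENNReal.ofReal (‖ξ‖ ^ (1 - 2 * H)) * C) := by
            rw [lintegral_const_mul _ (by fun_prop), lintegral_add_left (by fun_prop)]; gcongr
        _ = ENNReal.ofReal (K₂ * (‖ξ‖ ^ 2)⁻¹ * ‖ξ‖ ^ (-β) * ‖ξ‖ ^ (1 - 2 * H)) * (2 * C) := by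
            rw [ENNReal.ofReal_mul (q := ‖ξ‖ ^ (1 - 2 * H)) (by positivity)]; ring
        _ ≤ ENNReal.ofReal ((1 + ‖ξ‖) ^ (-B) * (K₂ * 2 ^ B)) * (2 * C) := by
            refine mul_le_mul' (ENNReal.ofReal_le_ofReal ?_) le_rfl
            have e : K₂ * (‖ξ‖ ^ 2)⁻¹ * ‖ξ‖ ^ (-β) * ‖ξ‖ ^ (1 - 2 * H) = ‖ξ‖ ^ (-B) * K₂ := by
              have : (‖ξ‖ ^ 2)⁻¹ = ‖ξ‖ ^ (-2:ℝ) := by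
                rw [Real.rpow_neg hu.le]; norm_cast
              rw [this, mul_assoc, mul_assoc, ← Real.rpow_add hu, ← Real.rpow_add hu, mul_comm]
              congr 2; rw [hB]; ring
            rw [e]
            have e2 : (1 + ‖ξ‖) ^ (-B) * (K₂ * 2 ^ B) = ((1 + ‖ξ‖) / 2) ^ (-B) * K₂ := by
              rw [Real.div_rpow (by positivity) (by norm_num), Real.rpow_neg (x := 2) (by norm_num)]
              field_simp
            rw [e2]
            have : ‖ξ‖ ^ (-B) ≤ ((1 + ‖ξ‖) / 2) ^ (-B) :=
              Real.rpow_le_rpow_of_nonpos (by positivity) (by linarith) (by linarith)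
            gcongr
        _ = _ := by rw [ENNReal.ofReal_mul (by positivity), mul_assoc]
  have ae0 : ∀ᵐ ξ : EuclideanSpace ℝ (Fin N), ξ ≠ 0 := by simp [ae_iff]
  refine (lintegral_mono_ae (ae0.mono key)).trans_lt ?_
  have mI : Measurable ((Metric.ball (0 : EuclideanSpace ℝ (Fin N)) 2).indicator
        (fun ξ => ENNReal.ofReal (‖ξ‖ ^ (-β)))) := Measurable.indicator (by fun_prop) measurableSet_ball
  rw [lintegral_add_right _ (by fun_prop), lintegral_mul_const _ mI, lintegral_mul_const _ (by fun_prop),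
    lintegral_indicator measurableSet_ball]
  refine ENNReal.add_lt_top.mpr ⟨ENNReal.mul_lt_top ?_ ?_, ENNReal.mul_lt_top ?_ ?_⟩
  · exact lint_norm_rpow_ball volume β 2 (by norm_num) (by simpa using hβN)
  · exact ENNReal.mul_lt_top (by simp) hC.lt_top
  · exact (integrable_one_add_norm (μ := volume) (E := EuclideanSpace ℝ (Fin N)) (r := B)
      (by simp; linarith)).lintegral_lt_top
  · exact ENNReal.mul_lt_top (by simp) (ENNReal.mul_lt_top (by simp) hC.lt_top)



lemma ae_snd_ne (N : ℕ) (hN : 1 ≤ N) : ∀ᵐ p : ℝ × EuclideanSpace ℝ (Fin N), p.2 ≠ 0 := by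
  have : Nonempty (Fin N) := ⟨⟨0, hN⟩⟩
  have ae0 : ∀ᵐ ξ : EuclideanSpace ℝ (Fin N), ξ ≠ 0 := by simp [ae_iff]
  exact Measure.quasiMeasurePreserving_snd.ae ae0

lemma integrable_G_mul (N : ℕ) (hN : 1 ≤ N) (H β : ℝ) (hH1 : 1 / 2 ≤ H) (hH2 : H < 1)
    (hβN : β < N)
    (hβlow : (N : ℝ) - 2 * H - 1 < β)
    (hfun : EuclideanSpace ℝ (Fin N) → ℝ) (hmeas : Measurable hfun)
    (c₁ c₂ : ℝ) (hc₁ : 0 < c₁)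
    (hflow : ∀ ξ : EuclideanSpace ℝ (Fin N), ξ ≠ 0 → c₁ * ‖ξ‖ ^ (-β) ≤ hfun ξ)
    (hfup : ∀ ξ : EuclideanSpace ℝ (Fin N), ξ ≠ 0 → hfun ξ ≤ c₂ * ‖ξ‖ ^ (-β))
    (z w : ℝ × EuclideanSpace ℝ (Fin N)) (hz : 0 ≤ z.1) (hw : 0 ≤ w.1) :
    Integrable (fun p : ℝ × EuclideanSpace ℝ (Fin N) =>
      Gker N z.1 z.2 p.1 p.2 * (starRingEnd ℂ) (Gker N w.1 w.2 p.1 p.2) *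
        ((|p.1| ^ (1 - 2 * H) * hfun p.2 : ℝ) : ℂ)) := by
  have base : ∀ z : ℝ × EuclideanSpace ℝ (Fin N), 0 ≤ z.1 →
      Integrable (fun p : ℝ × EuclideanSpace ℝ (Fin N) => ‖Gker N z.1 z.2 p.1 p.2‖ ^ 2 *
        (|p.1| ^ (1 - 2 * H) * ‖p.2‖ ^ (-β))) := by
    intro z hz
    have hm := measurable_Gker N z.1 z.2
    refine ⟨Measurable.aestronglyMeasurable (by fun_prop), ?_⟩
    rw [hasFiniteIntegral_iff_enorm]
    have : ∀ p : ℝ × EuclideanSpace ℝ (Fin N), ‖‖Gker N z.1 z.2 p.1 p.2‖ ^ 2 *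
        (|p.1| ^ (1 - 2 * H) * ‖p.2‖ ^ (-β))‖ₑ = ENNReal.ofReal (‖Gker N z.1 z.2 p.1 p.2‖ ^ 2 *
        (|p.1| ^ (1 - 2 * H) * ‖p.2‖ ^ (-β))) := fun p => Real.enorm_of_nonneg (by positivity)
    simp_rw [this]
    exact G_sq_finite N hN H β hH1 hH2 hβN hβlow z.1 hz z.2
  have hm1 := measurable_Gker N z.1 z.2
  have hm2 := measurable_Gker N w.1 w.2
  refine Integrable.mono' (((base z hz).add (base w hw)).const_mul c₂)
    (Measurable.aestronglyMeasurable (by fun_prop)) ?_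
  filter_upwards [ae_snd_ne N hN] with p hp
  have h0 : 0 ≤ hfun p.2 := le_trans (by positivity) (hflow _ hp)
  have h1 := hfup _ hp
  rw [norm_mul, norm_mul, RCLike.norm_conj, Complex.norm_real, Real.norm_eq_abs,
    abs_of_nonneg (by positivity)]
  set a := ‖Gker N z.1 z.2 p.1 p.2‖
  set b := ‖Gker N w.1 w.2 p.1 p.2‖
  have hab : a * b ≤ a ^ 2 + b ^ 2 := by nlinarith [sq_nonneg (a - b), sq_nonneg a, sq_nonneg b]
  have hP : 0 ≤ |p.1| ^ (1 - 2 * H) := by positivity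
  calc a * b * (|p.1| ^ (1 - 2 * H) * hfun p.2) ≤ (a ^ 2 + b ^ 2) * (|p.1| ^ (1 - 2 * H) * (c₂ * ‖p.2‖ ^ (-β))) := by
        gcongr
    _ = _ := by simp only [Pi.add_apply]; ring

lemma gram_entry (N : ℕ) (hN : 1 ≤ N) (H β : ℝ) (hH1 : 1 / 2 ≤ H) (hH2 : H < 1)
    (hβN : β < N)
    (hβlow : (N : ℝ) - 2 * H - 1 < β)
    (hfun : EuclideanSpace ℝ (Fin N) → ℝ) (hmeas : Measurable hfun)
    (c₁ c₂ : ℝ) (hc₁ : 0 < c₁)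
    (hflow : ∀ ξ : EuclideanSpace ℝ (Fin N), ξ ≠ 0 → c₁ * ‖ξ‖ ^ (-β) ≤ hfun ξ)
    (hfup : ∀ ξ : EuclideanSpace ℝ (Fin N), ξ ≠ 0 → hfun ξ ≤ c₂ * ‖ξ‖ ^ (-β))
    {n : ℕ} (z : Fin n → ℝ × EuclideanSpace ℝ (Fin N)) (hz : ∀ i, 0 ≤ (z i).1)
    (i j : Fin n) : gramMat N H hfun z i j = ∫ p : ℝ × EuclideanSpace ℝ (Fin N),
      (Gker N (z i).1 (z i).2 p.1 p.2 * (starRingEnd ℂ) (Gker N (z j).1 (z j).2 p.1 p.2)).re *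
        (|p.1| ^ (1 - 2 * H) * hfun p.2) := by
  have hI := integrable_G_mul N hN H β hH1 hH2 hβN hβlow hfun hmeas c₁ c₂ hc₁ hflow hfup
    (z i) (z j) (hz i) (hz j)
  simp only [gramMat, Matrix.of_apply]
  rw [Measure.volume_eq_prod] at hI
  have := integral_prod _ hI
  simp only at this
  rw [← this, ← Measure.volume_eq_prod]
  rw [Measure.volume_eq_prod] at *
  have h2 := integral_re (𝕜 := ℂ) hI
  simp only [RCLike.re_eq_complex_re] at h2
  rw [← h2]
  congr 1; ext p
  rw [Complex.re_mul_ofReal]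

lemma gram_quad (N : ℕ) (hN : 1 ≤ N) (H β : ℝ) (hH1 : 1 / 2 ≤ H) (hH2 : H < 1)
    (hβN : β < N)
    (hβlow : (N : ℝ) - 2 * H - 1 < β)
    (hfun : EuclideanSpace ℝ (Fin N) → ℝ) (hmeas : Measurable hfun)
    (c₁ c₂ : ℝ) (hc₁ : 0 < c₁)
    (hflow : ∀ ξ : EuclideanSpace ℝ (Fin N), ξ ≠ 0 → c₁ * ‖ξ‖ ^ (-β) ≤ hfun ξ)
    (hfup : ∀ ξ : EuclideanSpace ℝ (Fin N), ξ ≠ 0 → hfun ξ ≤ c₂ * ‖ξ‖ ^ (-β))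
    {n : ℕ} (z : Fin n → ℝ × EuclideanSpace ℝ (Fin N)) (hz : ∀ i, 0 ≤ (z i).1)
    (b : Fin n → ℝ) :
    ENNReal.ofReal c₁ * ∫⁻ p : ℝ × EuclideanSpace ℝ (Fin N),
      ENNReal.ofReal (‖∑ i, (b i : ℂ) * Gker N (z i).1 (z i).2 p.1 p.2‖ ^ 2 *
        (|p.1| ^ (1 - 2 * H) * ‖p.2‖ ^ (-β))) ≤
      ENNReal.ofReal (∑ i, ∑ j, b i * b j * gramMat N H hfun z i j) := by
  have hI : ∀ i j, Integrable (fun p : ℝ × EuclideanSpace ℝ (Fin N) => (Gker N (z i).1 (z i).2 p.1 p.2 * (starRingEnd ℂ) (Gker N (z j).1 (z j).2 p.1 p.2)).re *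
        (|p.1| ^ (1 - 2 * H) * hfun p.2)) := by
    intro i j
    have := (integrable_G_mul N hN H β hH1 hH2 hβN hβlow hfun hmeas c₁ c₂ hc₁ hflow hfup
      (z i) (z j) (hz i) (hz j)).re
    refine this.congr (Filter.Eventually.of_forall fun p => ?_)
    simp only [RCLike.re_eq_complex_re]
    rw [Complex.re_mul_ofReal]
  have hsq : ∀ p : ℝ × EuclideanSpace ℝ (Fin N),
      ∑ i, ∑ j, b i * b j * ((Gker N (z i).1 (z i).2 p.1 p.2 * (starRingEnd ℂ) (Gker N (z j).1 (z j).2 p.1 p.2)).re *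
        (|p.1| ^ (1 - 2 * H) * hfun p.2)) =
      ‖∑ i, (b i : ℂ) * Gker N (z i).1 (z i).2 p.1 p.2‖ ^ 2 * (|p.1| ^ (1 - 2 * H) * hfun p.2) := by
    intro p
    have : ((‖∑ i, (b i : ℂ) * Gker N (z i).1 (z i).2 p.1 p.2‖ ^ 2 : ℝ) : ℂ) =
      ∑ i, ∑ j, ((b i * b j : ℝ) : ℂ) * (Gker N (z i).1 (z i).2 p.1 p.2 * (starRingEnd ℂ) (Gker N (z j).1 (z j).2 p.1 p.2)) := by
      push_cast
      rw [← Complex.mul_conj', map_sum, Finset.sum_mul_sum]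
      refine Finset.sum_congr rfl fun i _ => Finset.sum_congr rfl fun j _ => ?_
      rw [map_mul, Complex.conj_ofReal]; ring
    have h2 := congrArg Complex.re this
    rw [Complex.ofReal_re, Complex.re_sum] at h2
    simp_rw [Complex.re_sum, Complex.re_ofReal_mul] at h2
    rw [h2, Finset.sum_mul]
    refine Finset.sum_congr rfl fun i _ => ?_
    rw [Finset.sum_mul]
    refine Finset.sum_congr rfl fun j _ => ?_
    ring
  have hsum : ∑ i, ∑ j, b i * b j * gramMat N H hfun z i j = ∫ p : ℝ × EuclideanSpace ℝ (Fin N),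
      ‖∑ i, (b i : ℂ) * Gker N (z i).1 (z i).2 p.1 p.2‖ ^ 2 * (|p.1| ^ (1 - 2 * H) * hfun p.2) := by
    simp_rw [← hsq]
    rw [integral_finset_sum _ fun i _ => integrable_finset_sum _ fun j _ => (hI i j).const_mul _]
    refine Finset.sum_congr rfl fun i _ => ?_
    rw [integral_finset_sum _ fun j _ => (hI i j).const_mul _]
    refine Finset.sum_congr rfl fun j _ => ?_
    rw [integral_const_mul, gram_entry N hN H β hH1 hH2 hβN hβlow hfun hmeas c₁ c₂ hc₁ hflow hfup z hz]
  have hInt : Integrable (fun p : ℝ × EuclideanSpace ℝ (Fin N) =>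
      ‖∑ i, (b i : ℂ) * Gker N (z i).1 (z i).2 p.1 p.2‖ ^ 2 * (|p.1| ^ (1 - 2 * H) * hfun p.2)) := by
    simp_rw [← hsq]
    exact integrable_finset_sum _ fun i _ => integrable_finset_sum _ fun j _ => (hI i j).const_mul _
  have hnn : ∀ᵐ p : ℝ × EuclideanSpace ℝ (Fin N), 0 ≤
      ‖∑ i, (b i : ℂ) * Gker N (z i).1 (z i).2 p.1 p.2‖ ^ 2 * (|p.1| ^ (1 - 2 * H) * hfun p.2) := by
    filter_upwards [ae_snd_ne N hN] with p hp
    have h0 : 0 ≤ hfun p.2 := le_trans (by positivity) (hflow _ hp)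
    positivity
  rw [hsum, ofReal_integral_eq_lintegral_ofReal hInt hnn]
  rw [← lintegral_const_mul' _ _ (by simp)]
  apply lintegral_mono_ae
  filter_upwards [ae_snd_ne N hN] with p hp
  rw [← ENNReal.ofReal_mul hc₁.le]
  apply ENNReal.ofReal_le_ofReal
  have hP : 0 ≤ |p.1| ^ (1 - 2 * H) := by positivity
  calc _ = ‖∑ i, (b i : ℂ) * Gker N (z i).1 (z i).2 p.1 p.2‖ ^ 2 * (|p.1| ^ (1 - 2 * H) * (c₁ * ‖p.2‖ ^ (-β))) := by ring
    _ ≤ _ := by gcongr; exact hflow _ hp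

lemma gram_symm (N : ℕ) (hN : 1 ≤ N) (H β : ℝ) (hH1 : 1 / 2 ≤ H) (hH2 : H < 1)
    (hβN : β < N)
    (hβlow : (N : ℝ) - 2 * H - 1 < β)
    (hfun : EuclideanSpace ℝ (Fin N) → ℝ) (hmeas : Measurable hfun)
    (c₁ c₂ : ℝ) (hc₁ : 0 < c₁)
    (hflow : ∀ ξ : EuclideanSpace ℝ (Fin N), ξ ≠ 0 → c₁ * ‖ξ‖ ^ (-β) ≤ hfun ξ)
    (hfup : ∀ ξ : EuclideanSpace ℝ (Fin N), ξ ≠ 0 → hfun ξ ≤ c₂ * ‖ξ‖ ^ (-β))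
    {n : ℕ} (z : Fin n → ℝ × EuclideanSpace ℝ (Fin N)) (hz : ∀ i, 0 ≤ (z i).1)
    (i j : Fin n) : gramMat N H hfun z i j = gramMat N H hfun z j i := by
  rw [gram_entry N hN H β hH1 hH2 hβN hβlow hfun hmeas c₁ c₂ hc₁ hflow hfup z hz,
    gram_entry N hN H β hH1 hH2 hβN hβlow hfun hmeas c₁ c₂ hc₁ hflow hfup z hz]
  congr 1; ext p
  congr 1
  simp only [Complex.mul_re, Complex.conj_re, Complex.conj_im]
  ring


lemma det_ge_prod : ∀ (n : ℕ) (Γ : Matrix (Fin n) (Fin n) ℝ) (_ : ∀ i j, Γ i j = Γ j i)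
    (D : Fin n → ℝ≥0∞) (_ : ∀ (k : Fin n) (b : Fin n → ℝ), b k = 1 → (∀ j, k < j → b j = 0) →
      D k ≤ ENNReal.ofReal (∑ i, ∑ j, b i * b j * Γ i j)),
    ∏ k, D k ≤ ENNReal.ofReal Γ.det := by
  intro n
  induction n with
  | zero => intro Γ _ D _; simp
  | succ n ih =>
    intro Γ hs D hD
    set A : Matrix (Fin n) (Fin n) ℝ := Γ.submatrix Fin.castSucc Fin.castSucc with hA
    have ihA := ih A (fun i j => hs _ _) (fun k => D k.castSucc) (by
      intro k b hb1 hb2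
      have := hD k.castSucc (Fin.snoc b 0) (by simpa using hb1) (by
        intro j hj
        induction j using Fin.lastCases with
        | last => simp
        | cast j => simpa using hb2 j (by simpa using hj))
      simpa [Fin.sum_univ_castSucc, hA] using this)
    rw [Fin.prod_univ_castSucc]
    rcases le_or_gt A.det 0 with h | h
    · rw [ENNReal.ofReal_of_nonpos h] at ihA
      rw [le_antisymm ihA (zero_le), zero_mul]
      exact zero_le
    · have hu : IsUnit A.det := h.ne'.isUnit
      set v : Fin n → ℝ := fun i => Γ i.castSucc (Fin.last n) with hv
      set y : Fin n → ℝ := A⁻¹.mulVec v with hy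
      have hAy : A.mulVec y = v := by
        rw [hy, Matrix.mulVec_mulVec, Matrix.mul_nonsing_inv _ hu, Matrix.one_mulVec]
      set q : ℝ := Γ (Fin.last n) (Fin.last n) - ∑ i, v i * y i with hq
      have hAy' : ∀ i, ∑ j, A i j * y j = v i := fun i => congrFun hAy i
      -- determinant
      have hdet : Γ.det = A.det * q := by
        let e : Fin n ⊕ Fin 1 ≃ Fin (n + 1) := finSumFinEquiv
        rw [← Matrix.det_submatrix_equiv_self e Γ]
        have : Γ.submatrix e e = Matrix.fromBlocks A (Matrix.of fun i _ => v i)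
            (Matrix.of fun _ j => v j) (Matrix.of fun _ _ => Γ (Fin.last n) (Fin.last n)) := by
          ext i j
          rcases i with i | i <;> rcases j with j | j
          · rfl
          · fin_cases j; rfl
          · fin_cases i; exact hs _ _
          · fin_cases i; fin_cases j; rfl
        rw [this]
        have hinv : Invertible A := Matrix.invertibleOfIsUnitDet A hu
        rw [Matrix.det_fromBlocks₁₁, Matrix.det_fin_one, Matrix.invOf_eq_nonsing_inv]
        congr 1
        rw [Matrix.mul_assoc]
        simp only [Matrix.sub_apply, Matrix.of_apply, Matrix.mul_apply, hq, hy, Matrix.mulVec, dotProduct]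
      have hquad : ∑ i, ∑ j, (Fin.snoc (fun i => - y i) 1 : Fin (n+1) → ℝ) i *
          (Fin.snoc (fun i => - y i) 1 : Fin (n+1) → ℝ) j * Γ i j = q := by
        simp only [Fin.sum_univ_castSucc, Fin.snoc_castSucc, Fin.snoc_last]
        have e1 : ∀ i : Fin n, ∑ j : Fin n, -y i * -y j * Γ i.castSucc j.castSucc + -y i * 1 * Γ i.castSucc (Fin.last n) = 0 := by
          intro i
          have : ∑ j : Fin n, -y i * -y j * Γ i.castSucc j.castSucc = y i * v i := by
            rw [← hAy' i, Finset.mul_sum]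
            refine Finset.sum_congr rfl fun j _ => ?_
            simp only [hA, Matrix.submatrix_apply]; ring
          rw [this]; simp only [hv]; ring
        simp only [e1, Finset.sum_const_zero, zero_add]
        rw [hq]
        have : ∑ x : Fin n, 1 * -y x * Γ (Fin.last n) x.castSucc = - ∑ i, v i * y i := by
          rw [← Finset.sum_neg_distrib]
          refine Finset.sum_congr rfl fun j _ => ?_
          rw [hs]; simp only [hv]; ring
        rw [this]; ring
      have hl := hD (Fin.last n) (Fin.snoc (fun i => - y i) 1) (by simp) (by
        intro j hj; exact absurd (Fin.le_last j) (not_le.mpr hj))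
      rw [hquad] at hl
      rw [hdet, ENNReal.ofReal_mul h.le]
      exact mul_le_mul' ihA hl

open scoped ENNReal SchwartzMap

lemma exists_test (c R : ℝ) (hR : 0 < R) : ∃ (p : 𝓢(ℝ, ℂ)) (ψ : ℝ → ℝ), Continuous ψ ∧
    (∀ s, 0 ≤ ψ s) ∧ ψ c = 1 ∧ (∀ s, R ≤ |s - c| → ψ s = 0) ∧
    ∀ s : ℝ, ∫ σ : ℝ, Complex.exp (-Complex.I * s * σ) * p σ = (ψ s : ℂ) := by
  have hpi : 0 < 2 * Real.pi := by positivity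
  let f : ContDiffBump (c / (2 * Real.pi)) :=
    { rIn := R / (2 * Real.pi) / 2, rOut := R / (2 * Real.pi), rIn_pos := by positivity,
      rIn_lt_rOut := by
        have : 0 < R / (2 * Real.pi) := by positivity
        linarith }
  let g : 𝓢(ℝ, ℂ) := HasCompactSupport.toSchwartzMap (f := fun x => ((f x : ℝ) : ℂ))
    (f.hasCompactSupport.comp_left (g := fun x : ℝ => (x : ℂ)) (by simp))
    (Complex.ofRealCLM.contDiff.comp f.contDiff)
  have hg : ∀ x, g x = ((f x : ℝ) : ℂ) := fun x => rfl
  refine ⟨FourierTransform.fourierInv g, fun s => f (s / (2 * Real.pi)), ?_, ?_, ?_, ?_, ?_⟩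
  · exact f.continuous.comp (by fun_prop)
  · intro s; exact f.nonneg
  · exact f.one_of_mem_closedBall (Metric.mem_closedBall_self (f.rIn_pos.le))
  · intro s hs
    apply f.zero_of_le_dist
    rw [Real.dist_eq, ← sub_div, abs_div, abs_of_pos hpi]
    change R / (2 * Real.pi) ≤ _
    gcongr
  · intro s
    have h1 : FourierTransform.fourier (FourierTransform.fourierInv g) = g :=
      FourierTransform.fourier_fourierInv_eq g
    have h2 := congrArg (fun h : 𝓢(ℝ, ℂ) => h (s / (2 * Real.pi))) h1
    simp only [SchwartzMap.fourier_coe] at h2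
    rw [Real.fourier_eq', hg] at h2
    rw [← h2]
    congr 1; ext σ
    rw [smul_eq_mul]
    congr 2
    simp
    have : (Real.pi : ℂ) ≠ 0 := by exact_mod_cast Real.pi_ne_zero
    field_simp

open scoped ENNReal SchwartzMap

noncomputable def ee (r : ℝ) : ℂ := Complex.exp (-Complex.I * (r : ℂ))

lemma ee_add (a b : ℝ) : ee (a + b) = ee a * ee b := by
  simp only [ee]; rw [← Complex.exp_add]; congr 1; push_cast; ring

lemma norm_ee (a : ℝ) : ‖ee a‖ = 1 := by
  have := norm_exp_aux a 1
  simpa [ee] using this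

lemma continuous_ee : Continuous ee := by unfold ee; fun_prop

lemma ee_mul (s τ : ℝ) : Complex.exp (-Complex.I * s * τ) = ee (s * τ) := by
  simp [ee, mul_assoc]

lemma sin_ee (x : ℝ) : ((Real.sin x : ℝ) : ℂ) = (1 / (2 * Complex.I)) * (ee (-x) - ee x) := by
  simp only [ee, Complex.ofReal_sin, Complex.sin]
  push_cast
  have h1 : -Complex.I * -(x:ℂ) = x * Complex.I := by ring
  have h2 : -Complex.I * (x:ℂ) = -x * Complex.I := by ring
  rw [h1, h2]
  field_simp
  rw [Complex.I_sq]; ring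

noncomputable def mm (t τ u : ℝ) : ℂ := ∫ s in (0:ℝ)..t, (Real.sin ((t - s) * u) : ℂ) * ee (s * τ)

lemma mm_eq (t τ u : ℝ) : (u : ℂ) * kk t τ u = mm t τ u := by
  unfold mm kk
  rw [← intervalIntegral.integral_const_mul]
  congr 1; ext s
  rw [ee_mul]
  rcases eq_or_ne u 0 with rfl | hu
  · simp
  · have : (u:ℂ) ≠ 0 := by exact_mod_cast hu
    push_cast; field_simp

lemma continuous_mm (t : ℝ) : Continuous fun p : ℝ × ℝ => mm t p.1 p.2 := by
  unfold mm
  apply intervalIntegral.continuous_parametric_intervalIntegral_of_continuous'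
  have := continuous_ee
  unfold Function.uncurry
  fun_prop

lemma norm_mm_le (t τ u : ℝ) (ht : 0 ≤ t) : ‖mm t τ u‖ ≤ t := by
  rw [← mm_eq, norm_mul, mul_comm]
  simpa using norm_kk_mul_le t τ u ht

/-- inner integral -/
lemma inner_tau (p : 𝓢(ℝ, ℂ)) (ψ : ℝ → ℝ)
    (hψ : ∀ s : ℝ, ∫ σ : ℝ, Complex.exp (-Complex.I * s * σ) * p σ = (ψ s : ℂ))
    (t u : ℝ) (ht : 0 ≤ t) :
    ∫ τ : ℝ, mm t τ u * p (τ + u) =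
      ∫ s in (0:ℝ)..t, (Real.sin ((t - s) * u) : ℂ) * (ee (-(s * u)) * (ψ s : ℂ)) := by
  unfold mm
  simp_rw [intervalIntegral.integral_of_le ht, ← integral_mul_const]
  have hpi : Integrable (fun τ => p (τ + u)) := (p.integrable (μ := volume)).comp_add_right u
  rw [integral_integral_swap]
  · congr 1; ext s
    have : ∀ τ, (Real.sin ((t - s) * u) : ℂ) * ee (s * τ) * p (τ + u) =
      (fun σ : ℝ => (Real.sin ((t - s) * u) : ℂ) * (ee (-(s * u)) *
        (Complex.exp (-Complex.I * s * σ) * p σ))) (τ + u) := by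
      intro τ
      simp only [ee_mul]
      have : ee (s * τ) = ee (-(s*u)) * ee (s * (τ + u)) := by rw [← ee_add]; congr 1; ring
      rw [this]; ring
    refine (integral_congr_ae (Filter.Eventually.of_forall this)).trans ?_
    refine (integral_add_right_eq_self (μ := volume) (fun σ : ℝ => (Real.sin ((t - s) * u) : ℂ) *
      (ee (-(s * u)) * (Complex.exp (-Complex.I * s * σ) * p σ))) u).trans ?_
    rw [integral_const_mul, integral_const_mul, hψ]
  · have hc := continuous_ee
    have hp := p.continuous
    have h1 : Integrable (fun q : ℝ × ℝ => p (q.1 + u) * (1:ℂ))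
      (volume.prod (volume.restrict (Ioc 0 t))) := hpi.mul_prod (integrable_const 1)
    refine h1.norm.mono' (Continuous.aestronglyMeasurable ?_) ?_
    · unfold Function.uncurry; fun_prop
    · refine Filter.Eventually.of_forall fun q => ?_
      simp only [Function.uncurry, norm_mul, norm_ee, mul_one, Complex.norm_real, norm_one]
      have : ‖Real.sin ((t - q.2) * u)‖ ≤ 1 := Real.abs_sin_le_one _
      exact mul_le_of_le_one_left (norm_nonneg _) this

lemma four_scale (q : 𝓢(ℝ, ℂ)) (φ : ℝ → ℝ)
    (hφ : ∀ s : ℝ, ∫ σ : ℝ, Complex.exp (-Complex.I * s * σ) * q σ = (φ s : ℂ))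
    (ρ : ℝ) (hρ : 0 < ρ) (r : ℝ) :
    ∫ u : ℝ, ee (u * r) * q (ρ * u) = ((1/ρ : ℝ) : ℂ) * (φ (r / ρ) : ℂ) := by
  have := Measure.integral_comp_mul_left (fun v => ee (v * (r/ρ)) * q v) ρ
  simp only [abs_inv, abs_of_pos hρ] at this
  have e : ∀ u : ℝ, ee (u * r) * q (ρ * u) = ee (ρ * u * (r/ρ)) * q (ρ * u) := by
    intro u; congr 2; field_simp
  simp_rw [e]
  rw [this, ← hφ]
  simp only [ee_mul, one_div, Complex.real_smul]
  congr 2; ext v; rw [mul_comm v]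

lemma outer_u (q : 𝓢(ℝ, ℂ)) (φ : ℝ → ℝ)
    (hφ : ∀ s : ℝ, ∫ σ : ℝ, Complex.exp (-Complex.I * s * σ) * q σ = (φ s : ℂ))
    (ρ : ℝ) (hρ : 0 < ρ) (t y : ℝ) (ht : 0 ≤ t) (ψ : ℝ → ℝ) (hψ : Continuous ψ) :
    ∫ u : ℝ, ee (u * y) * q (ρ * u) * ∫ s in (0:ℝ)..t, (Real.sin ((t - s) * u) : ℂ) *
        (ee (-(s * u)) * (ψ s : ℂ)) =
      (1 / (2 * Complex.I)) * ((1/ρ : ℝ) : ℂ) * ∫ s in (0:ℝ)..t, (ψ s : ℂ) *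
        ((φ ((y - t) / ρ) : ℂ) - (φ ((y + t - 2 * s) / ρ) : ℂ)) := by
  simp_rw [intervalIntegral.integral_of_le ht, ← integral_const_mul]
  have hqi : Integrable (fun u => q (ρ * u)) :=
    (q.integrable (μ := volume)).comp_mul_left' hρ.ne'
  have hc := continuous_ee
  have hq := q.continuous
  rw [integral_integral_swap]
  · congr 1; ext s
    have : ∀ u, ee (u * y) * q (ρ * u) * ((Real.sin ((t - s) * u) : ℂ) *
        (ee (-(s * u)) * (ψ s : ℂ))) = ((1 / (2 * Complex.I)) * (ψ s : ℂ)) *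
        (ee (u * (y - t)) * q (ρ * u) - ee (u * (y + t - 2 * s)) * q (ρ * u)) := by
      intro u
      rw [sin_ee]
      have h1 : ee (u * (y - t)) = ee (u * y) * (ee (-((t-s)*u)) * ee (-(s * u))) := by
        rw [← ee_add, ← ee_add]; congr 1; ring
      have h2 : ee (u * (y + t - 2 * s)) = ee (u * y) * (ee (((t-s)*u)) * ee (-(s * u))) := by
        rw [← ee_add, ← ee_add]; congr 1; ring
      rw [h1, h2]; ring
    simp_rw [this]
    have hInteg : ∀ r : ℝ, Integrable (fun u => ee (u * r) * q (ρ * u)) := by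
      intro r
      refine hqi.norm.mono' (Continuous.aestronglyMeasurable (by fun_prop)) ?_
      exact Filter.Eventually.of_forall fun u => by rw [norm_mul, norm_ee, one_mul]
    rw [integral_const_mul, integral_sub (hInteg _) (hInteg _), four_scale q φ hφ ρ hρ,
      four_scale q φ hφ ρ hρ]
    ring
  · have h0 : Integrable (fun s => (ψ s : ℂ)) (volume.restrict (Ioc 0 t)) := by
      refine (Continuous.integrableOn_Ioc (by fun_prop))
    have h1 := hqi.mul_prod h0
    refine h1.norm.mono' (Continuous.aestronglyMeasurable ?_) ?_
    · unfold Function.uncurry; fun_prop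
    · refine Filter.Eventually.of_forall fun p => ?_
      simp only [Function.uncurry, norm_mul, norm_ee, one_mul, Complex.norm_real]
      have : ‖Real.sin ((t - p.2) * p.1)‖ ≤ 1 := Real.abs_sin_le_one _
      gcongr
      exact mul_le_of_le_one_left (norm_nonneg _) this

lemma integrable_shear (f g : ℝ → ℂ) (hf : Integrable f) (hg : Integrable g) :
    Integrable (fun p : ℝ × ℝ => f (p.1 + p.2) * g p.2) := by
  have h := hf.mul_prod hg
  have hm := (measurePreserving_add_prod (volume : Measure ℝ) (volume : Measure ℝ))
  exact (hm.integrable_comp h.aestronglyMeasurable).2 h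

lemma integrable_term (p q : 𝓢(ℝ, ℂ)) (ρ : ℝ) (hρ : 0 < ρ) (t y : ℝ) (ht : 0 ≤ t) :
    Integrable (fun x : ℝ × ℝ => (ee (x.2 * y) * mm t x.1 x.2) * (p (x.1 + x.2) * q (ρ * x.2))) := by
  have hqi : Integrable (fun u => q (ρ * u)) :=
    (q.integrable (μ := volume)).comp_mul_left' hρ.ne'
  have h := integrable_shear p _ (p.integrable (μ := volume)) hqi
  refine (h.norm.const_mul t).mono' (Continuous.aestronglyMeasurable ?_) ?_
  · have hc := continuous_ee
    have hq := q.continuous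
    have hp := p.continuous
    have := continuous_mm t
    fun_prop
  · refine Filter.Eventually.of_forall fun x => ?_
    simp only [norm_mul, norm_ee, one_mul]
    have := norm_mm_le t x.1 x.2 ht
    gcongr

lemma term_value (p q : 𝓢(ℝ, ℂ)) (ψ φ : ℝ → ℝ) (hψc : Continuous ψ)
    (hψ : ∀ s : ℝ, ∫ σ : ℝ, Complex.exp (-Complex.I * s * σ) * p σ = (ψ s : ℂ))
    (hφ : ∀ s : ℝ, ∫ σ : ℝ, Complex.exp (-Complex.I * s * σ) * q σ = (φ s : ℂ))
    (ρ : ℝ) (hρ : 0 < ρ) (t y : ℝ) (ht : 0 ≤ t) :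
    ∫ x : ℝ × ℝ, (ee (x.2 * y) * mm t x.1 x.2) * (p (x.1 + x.2) * q (ρ * x.2)) =
      (1 / (2 * Complex.I)) * ((1/ρ : ℝ) : ℂ) * ∫ s in (0:ℝ)..t, (ψ s : ℂ) *
        ((φ ((y - t) / ρ) : ℂ) - (φ ((y + t - 2 * s) / ρ) : ℂ)) := by
  have hi := integrable_term p q ρ hρ t y ht
  rw [Measure.volume_eq_prod] at hi ⊢
  rw [integral_prod_symm _ hi, ← outer_u q φ hφ ρ hρ t y ht ψ hψc]
  congr 1; ext u
  rw [← inner_tau p ψ hψ t u ht, ← integral_const_mul]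
  congr 1; ext τ
  simp only
  ring

open scoped ENNReal SchwartzMap

lemma cs_weight {X : Type*} [MeasurableSpace X] (μ : Measure X) (F Ψ : X → ℂ) (w : X → ℝ)
    (hF : Measurable F) (hΨ : Measurable Ψ) (hw : Measurable w) (hpos : ∀ᵐ x ∂μ, 0 < w x) :
    ENNReal.ofReal (‖∫ x, F x * Ψ x ∂μ‖ ^ 2) ≤ (∫⁻ x, ENNReal.ofReal (‖F x‖ ^ 2 * w x) ∂μ) *
      ∫⁻ x, ENNReal.ofReal (‖Ψ x‖ ^ 2 * (w x)⁻¹) ∂μ := by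
  have h1 : ENNReal.ofReal ‖∫ x, F x * Ψ x ∂μ‖ ≤ ∫⁻ x, ENNReal.ofReal (‖F x‖ * ‖Ψ x‖) ∂μ := by
    rw [ofReal_norm]
    refine (enorm_integral_le_lintegral_enorm _).trans (le_of_eq ?_)
    congr 1; ext x; rw [← norm_mul, ofReal_norm]
  have h2 := ENNReal.lintegral_mul_le_Lp_mul_Lq μ (p := 2) (q := 2)
    (by constructor <;> norm_num)
    (f := fun x => ENNReal.ofReal (‖F x‖ * Real.sqrt (w x)))
    (g := fun x => ENNReal.ofReal (‖Ψ x‖ * (Real.sqrt (w x))⁻¹)) (by fun_prop) (by fun_prop)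
  have h3 : ∫⁻ x, ENNReal.ofReal (‖F x‖ * ‖Ψ x‖) ∂μ =
     ∫⁻ x, ((fun x => ENNReal.ofReal (‖F x‖ * Real.sqrt (w x))) *
       (fun x => ENNReal.ofReal (‖Ψ x‖ * (Real.sqrt (w x))⁻¹))) x ∂μ := by
    refine lintegral_congr_ae ?_
    filter_upwards [hpos] with x hx
    simp only [Pi.mul_apply]
    rw [← ENNReal.ofReal_mul (by positivity)]
    congr 1
    have := Real.sqrt_pos.2 hx
    field_simp
  have e1 : ∀ᵐ x ∂μ, ENNReal.ofReal (‖F x‖ * Real.sqrt (w x)) ^ (2:ℝ) =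
      ENNReal.ofReal (‖F x‖ ^ 2 * w x) := by
    filter_upwards [hpos] with x hx
    rw [ENNReal.ofReal_rpow_of_nonneg (by positivity) (by norm_num)]
    congr 1
    rw [Real.rpow_two, mul_pow, Real.sq_sqrt hx.le]
  have e2 : ∀ᵐ x ∂μ, ENNReal.ofReal (‖Ψ x‖ * (Real.sqrt (w x))⁻¹) ^ (2:ℝ) =
      ENNReal.ofReal (‖Ψ x‖ ^ 2 * (w x)⁻¹) := by
    filter_upwards [hpos] with x hx
    rw [ENNReal.ofReal_rpow_of_nonneg (by positivity) (by norm_num)]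
    congr 1
    rw [Real.rpow_two, mul_pow, inv_pow, Real.sq_sqrt hx.le]
  rw [lintegral_congr_ae e1, lintegral_congr_ae e2] at h2
  rw [← h3] at h2
  have h4 := h1.trans h2
  rw [ENNReal.ofReal_pow (norm_nonneg _)]
  calc _ ≤ (_ * _) ^ 2 := pow_le_pow_left' h4 2
    _ = _ := by
      rw [mul_pow, ← ENNReal.rpow_natCast, ← ENNReal.rpow_natCast, ← ENNReal.rpow_mul,
        ← ENNReal.rpow_mul]
      norm_num

lemma schwartz_moment (q : 𝓢(ℝ, ℂ)) (s : ℝ) (hs : 0 ≤ s) :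
    ∫⁻ v : ℝ, ENNReal.ofReal (‖q v‖ ^ 2 * |v| ^ s) < ∞ := by
  obtain ⟨M, hM⟩ : ∃ M, ∀ x, ‖q x‖ ≤ M := by
    obtain ⟨M, hM⟩ := q.decay 0 0
    exact ⟨M, fun x => by simpa using hM.2 x⟩
  obtain ⟨k, hk⟩ := exists_nat_ge s
  have hi : Integrable (fun v : ℝ => M * (‖v‖ ^ 0 * ‖q v‖ + ‖v‖ ^ k * ‖q v‖)) :=
    ((q.integrable_pow_mul volume 0).add (q.integrable_pow_mul volume k)).const_mul M
  refine lt_of_le_of_lt (lintegral_mono fun v => ENNReal.ofReal_le_ofReal ?_) hi.lintegral_lt_top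
  have hv : |v| ^ s ≤ 1 + |v| ^ k := by
    rcases le_total |v| 1 with h | h
    · have := Real.rpow_le_one (abs_nonneg v) h hs
      have : 0 ≤ |v|^k := by positivity
      linarith
    · have := Real.rpow_le_rpow_of_exponent_le h hk
      rw [Real.rpow_natCast] at this
      linarith
  have h0 := norm_nonneg (q v)
  have hM0 : 0 ≤ M := h0.trans (hM v)
  calc ‖q v‖ ^ 2 * |v| ^ s ≤ (M * ‖q v‖) * (1 + |v| ^ k) := by
        have : ‖q v‖^2 ≤ M * ‖q v‖ := by rw [sq]; exact mul_le_mul_of_nonneg_right (hM v) h0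
        gcongr
    _ = _ := by simp only [pow_zero, Real.norm_eq_abs]; ring

lemma lint_scale (f : ℝ → ℝ≥0∞) (ρ : ℝ) (hρ : 0 < ρ) :
    ∫⁻ u, f (ρ * u) = ENNReal.ofReal (ρ⁻¹) * ∫⁻ u, f u := by
  have h := Real.map_volume_mul_left hρ.ne'
  have e : MeasurableEmbedding (fun u : ℝ => ρ * u) :=
    (Homeomorph.mulLeft₀ ρ hρ.ne').measurableEmbedding
  have := e.lintegral_map f (μ := volume)
  rw [← this]
  change ∫⁻ a, f a ∂(Measure.map (ρ * ·) volume) = _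
  rw [h, lintegral_smul_measure, abs_of_pos (by positivity)]
  rfl

lemma test_norm (p q : 𝓢(ℝ, ℂ)) (γ e R : ℝ) (hγ0 : 0 ≤ γ) (hγ1 : γ ≤ 1) (he : e ≤ 2) (hR : 0 < R) :
    ∃ K : ℝ, 0 < K ∧ ∀ ρ, 0 < ρ → ρ ≤ R → ∀ c : ℝ,
      ∫⁻ x : ℝ × ℝ, ENNReal.ofReal (‖ee (x.2 * c) * (x.2 : ℂ) * (p (x.1 + x.2) * q (ρ * x.2))‖ ^ 2 *
        (|x.1| ^ (-γ) * |x.2| ^ e)⁻¹) ≤ ENNReal.ofReal (K * ρ ^ (-3 - γ + e)) := by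
  set A := ∫⁻ v : ℝ, ENNReal.ofReal (‖p v‖ ^ 2 * |v| ^ γ) with hA
  set B := ∫⁻ v : ℝ, ENNReal.ofReal (‖p v‖ ^ 2 * |v| ^ (0:ℝ)) with hB
  set A' := ∫⁻ v : ℝ, ENNReal.ofReal (‖q v‖ ^ 2 * |v| ^ (2 - e)) with hA'
  set B' := ∫⁻ v : ℝ, ENNReal.ofReal (‖q v‖ ^ 2 * |v| ^ (2 - e + γ)) with hB'
  have fA : A ≠ ∞ := (schwartz_moment p γ hγ0).ne
  have fB : B ≠ ∞ := (schwartz_moment p 0 le_rfl).ne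
  have fA' : A' ≠ ∞ := (schwartz_moment q (2 - e) (by linarith)).ne
  have fB' : B' ≠ ∞ := (schwartz_moment q (2 - e + γ) (by linarith)).ne
  refine ⟨A.toReal * A'.toReal * R ^ γ + B.toReal * B'.toReal + 1, by positivity, ?_⟩
  intro ρ hρ hρR c
  have hp := p.continuous
  have hq := q.continuous
  have hce := continuous_ee
  have meas : Measurable fun x : ℝ × ℝ => ENNReal.ofReal (‖ee (x.2 * c) * (x.2 : ℂ) * (p (x.1 + x.2) * q (ρ * x.2))‖ ^ 2 *
        (|x.1| ^ (-γ) * |x.2| ^ e)⁻¹) := by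
    have : Measurable fun x : ℝ × ℝ => ee (x.2 * c) * (x.2 : ℂ) * (p (x.1 + x.2) * q (ρ * x.2)) :=
      Continuous.measurable (by fun_prop)
    fun_prop
  rw [Measure.volume_eq_prod, lintegral_prod_symm _ meas.aemeasurable]
  -- pointwise inner bound
  have inner : ∀ u : ℝ, u ≠ 0 → ∫⁻ τ : ℝ, ENNReal.ofReal (‖ee (u * c) * (u : ℂ) * (p (τ + u) * q (ρ * u))‖ ^ 2 *
        (|τ| ^ (-γ) * |u| ^ e)⁻¹) ≤
      A * ENNReal.ofReal (|u| ^ (2 - e) * ‖q (ρ * u)‖ ^ 2) +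
      B * ENNReal.ofReal (|u| ^ (2 - e + γ) * ‖q (ρ * u)‖ ^ 2) := by
    intro u hu
    have hu' : 0 < |u| := abs_pos.2 hu
    calc _ ≤ ∫⁻ τ : ℝ, (fun σ : ℝ => ENNReal.ofReal (‖p σ‖ ^ 2 * |σ| ^ γ) *
            ENNReal.ofReal (|u| ^ (2 - e) * ‖q (ρ * u)‖ ^ 2) +
          ENNReal.ofReal (‖p σ‖ ^ 2 * |σ| ^ (0:ℝ)) *
            ENNReal.ofReal (|u| ^ (2 - e + γ) * ‖q (ρ * u)‖ ^ 2)) (τ + u) := by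
          refine lintegral_mono fun τ => ?_
          simp only
          rw [← ENNReal.ofReal_mul (by positivity), ← ENNReal.ofReal_mul (by positivity),
            ← ENNReal.ofReal_add (by positivity) (by positivity)]
          refine ENNReal.ofReal_le_ofReal ?_
          simp only [norm_mul, norm_ee, one_mul, Complex.norm_real, Real.norm_eq_abs]
          have h1 : |τ| ^ γ ≤ |τ + u| ^ γ + |u| ^ γ := by
            have : |τ| ≤ |τ + u| + |u| := by
              have := abs_sub (τ + u) u
              simpa using this
            exact (Real.rpow_le_rpow (abs_nonneg _) this hγ0).trans
              (Real.rpow_add_le_add_rpow (abs_nonneg _) (abs_nonneg _) hγ0 hγ1)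
          have h2 : (|τ| ^ (-γ) * |u| ^ e)⁻¹ = |τ| ^ γ * |u| ^ (-e) := by
            rw [mul_inv, Real.rpow_neg (abs_nonneg τ), inv_inv, Real.rpow_neg (abs_nonneg u)]
          have h3 : |u| ^ (2 - e) = |u| ^ 2 * |u| ^ (-e) := by
            rw [← Real.rpow_two, ← Real.rpow_add hu']; rfl
          have h4 : |u| ^ (2 - e + γ) = |u| ^ 2 * |u| ^ (-e) * |u| ^ γ := by
            rw [Real.rpow_add hu', h3]
          rw [h2, h3, h4, Real.rpow_zero]
          have h5 : 0 ≤ (‖p (τ + u)‖ ^ 2 * (|u| ^ 2 * |u| ^ (-e)) * ‖q (ρ * u)‖ ^ 2) := by positivity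
          calc _ = |τ| ^ γ * (‖p (τ + u)‖ ^ 2 * (|u| ^ 2 * |u| ^ (-e)) * ‖q (ρ * u)‖ ^ 2) := by ring
            _ ≤ (|τ + u| ^ γ + |u| ^ γ) * (‖p (τ + u)‖ ^ 2 * (|u| ^ 2 * |u| ^ (-e)) * ‖q (ρ * u)‖ ^ 2) := by gcongr
            _ = _ := by ring
      _ = _ := by
          refine (lintegral_add_right_eq_self (μ := volume) (fun σ : ℝ =>
            ENNReal.ofReal (‖p σ‖ ^ 2 * |σ| ^ γ) *
            ENNReal.ofReal (|u| ^ (2 - e) * ‖q (ρ * u)‖ ^ 2) +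
            ENNReal.ofReal (‖p σ‖ ^ 2 * |σ| ^ (0:ℝ)) *
            ENNReal.ofReal (|u| ^ (2 - e + γ) * ‖q (ρ * u)‖ ^ 2)) u).trans ?_
          rw [lintegral_add_left (by fun_prop),
            lintegral_mul_const _ (by fun_prop), lintegral_mul_const _ (by fun_prop)]
  have outer : ∀ s : ℝ, ∫⁻ u : ℝ, ENNReal.ofReal (|u| ^ s * ‖q (ρ * u)‖ ^ 2) =
      ENNReal.ofReal (ρ ^ (-1 - s)) * ∫⁻ v : ℝ, ENNReal.ofReal (‖q v‖ ^ 2 * |v| ^ s) := by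
    intro s
    have := lint_scale (fun v => ENNReal.ofReal (‖q v‖ ^ 2 * |v| ^ s)) ρ hρ
    have h2 : ∀ u : ℝ, ENNReal.ofReal (|u| ^ s * ‖q (ρ * u)‖ ^ 2) = ENNReal.ofReal (ρ ^ (-s)) *
        ENNReal.ofReal (‖q (ρ * u)‖ ^ 2 * |ρ * u| ^ s) := by
      intro u
      rw [← ENNReal.ofReal_mul (by positivity), abs_mul, abs_of_pos hρ,
        Real.mul_rpow hρ.le (abs_nonneg _), Real.rpow_neg hρ.le]
      congr 1
      have : ρ ^ s ≠ 0 := by positivity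
      field_simp
    simp_rw [h2]
    rw [lintegral_const_mul _ (by fun_prop), this, ← mul_assoc, ← ENNReal.ofReal_mul (by positivity)]
    congr 2
    rw [← Real.rpow_neg_one, ← Real.rpow_add hρ]; congr 1; ring
  have ae0 : ∀ᵐ u : ℝ, u ≠ 0 := by simp [ae_iff]
  calc _ ≤ ∫⁻ u : ℝ, (A * ENNReal.ofReal (|u| ^ (2 - e) * ‖q (ρ * u)‖ ^ 2) +
      B * ENNReal.ofReal (|u| ^ (2 - e + γ) * ‖q (ρ * u)‖ ^ 2)) := by
        refine lintegral_mono_ae ?_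
        filter_upwards [ae0] with u hu using inner u hu
    _ = A * (ENNReal.ofReal (ρ ^ (-1 - (2 - e))) * A') + B * (ENNReal.ofReal (ρ ^ (-1 - (2 - e + γ))) * B') := by
        rw [lintegral_add_left (by fun_prop), lintegral_const_mul _ (by fun_prop),
          lintegral_const_mul _ (by fun_prop), outer, outer]
    _ = ENNReal.ofReal (A.toReal * A'.toReal * ρ ^ (-3 + e) + B.toReal * B'.toReal * ρ ^ (-3 - γ + e)) := by
        rw [← ENNReal.ofReal_toReal fA, ← ENNReal.ofReal_toReal fA', ← ENNReal.ofReal_toReal fB,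
          ← ENNReal.ofReal_toReal fB', ← ENNReal.ofReal_mul (by positivity),
          ← ENNReal.ofReal_mul (by positivity), ← ENNReal.ofReal_mul (by positivity),
          ← ENNReal.ofReal_mul (by positivity), ← ENNReal.ofReal_add (by positivity) (by positivity)]
        simp only [ENNReal.toReal_ofReal ENNReal.toReal_nonneg]
        have x1 : -1 - (2 - e) = -3 + e := by ring
        have x2 : -1 - (2 - e + γ) = -3 - γ + e := by ring
        rw [x1, x2]
        congr 1; ring
    _ ≤ _ := by
        refine ENNReal.ofReal_le_ofReal ?_
        have h1 : ρ ^ (-3 + e) ≤ R ^ γ * ρ ^ (-3 - γ + e) := by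
          have : ρ ^ (-3 + e) = ρ ^ γ * ρ ^ (-3 - γ + e) := by
            rw [← Real.rpow_add hρ]; congr 1; ring
          rw [this]
          gcongr
        have h2 : 0 ≤ A.toReal * A'.toReal := by positivity
        have h3 : 0 ≤ ρ ^ (-3 - γ + e) := by positivity
        nlinarith [mul_le_mul_of_nonneg_left h1 h2]

open scoped ENNReal SchwartzMap

lemma measurable_kk (t : ℝ) : Measurable fun x : ℝ × ℝ => kk t x.1 x.2 := by
  have hc := continuous_ee
  have : (fun x : ℝ × ℝ => kk t x.1 x.2) = fun x => ∫ s in (0:ℝ)..t,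
      (fun (y : ℝ × ℝ) (s : ℝ) => ((Real.sin ((t - s) * y.2) / y.2 : ℝ) : ℂ) * ee (s * y.1)) x s := by
    ext x; simp only [kk, ee_mul]
  rw [this]
  simp only [intervalIntegral]
  refine Measurable.sub ?_ ?_
  · refine (StronglyMeasurable.integral_prod_right (ν := volume.restrict (Ioc 0 t)) ?_).measurable
    refine Measurable.stronglyMeasurable ?_
    unfold Function.uncurry
    have := hc.measurable
    fun_prop
  · refine (StronglyMeasurable.integral_prod_right (ν := volume.restrict (Ioc t 0)) ?_).measurable
    refine Measurable.stronglyMeasurable ?_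
    unfold Function.uncurry
    have := hc.measurable
    fun_prop

/-- one-dimensional strong local nondeterminism -/
lemma slnd_one (a γ e : ℝ) (ha : 0 < a) (hγ0 : 0 ≤ γ) (hγ1 : γ ≤ 1) (he : e ≤ 2) :
    ∃ c : ℝ, 0 < c ∧ ∀ (ι : Type) (_ : Fintype ι) (t y b : ι → ℝ) (t0 y0 ρ : ℝ), a ≤ t0 →
      (∀ j, a ≤ t j) → (∀ j, |y j - y0| ≤ a / 4) → 0 < ρ → ρ ≤ a / 2 →
      (∀ j, ρ ≤ |(t j - y j) - (t0 - y0)|) →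
      ENNReal.ofReal (c * ρ ^ (γ + 1 - e)) ≤
        ∫⁻ x : ℝ × ℝ, ENNReal.ofReal (‖ee (x.2 * y0) * kk t0 x.1 x.2 +
          ∑ j, (b j : ℂ) * (ee (x.2 * y j) * kk (t j) x.1 x.2)‖ ^ 2 *
            (|x.1| ^ (-γ) * |x.2| ^ e)) := by
  obtain ⟨p, ψ, hψc, hψ0, hψ1, hψs, hψ⟩ := exists_test (a/4) (a/4) (by positivity)
  obtain ⟨q, φ, hφc, hφ0, hφ1, hφs, hφ⟩ := exists_test 0 1 (by positivity)
  obtain ⟨K, hK, hKb⟩ := test_norm p q γ e (a/2) hγ0 hγ1 he (by positivity)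
  set m := ∫ s in (0:ℝ)..a, ψ s with hm
  have hmpos : 0 < m := by
    refine intervalIntegral.integral_pos ha hψc.continuousOn (fun x _ => hψ0 x)
      ⟨a/4, ⟨by positivity, by linarith⟩, by rw [hψ1]; norm_num⟩
  refine ⟨(m / 2) ^ 2 / K, by positivity, ?_⟩
  intro ι _ t y b t0 y0 ρ ht0 ht hy hρ hρa hsep
  set c := t0 - y0 with hc
  have hce := continuous_ee
  have hp := p.continuous
  have hq := q.continuous
  have hkm := measurable_kk
  set F : ℝ × ℝ → ℂ := fun x => ee (x.2 * y0) * kk t0 x.1 x.2 +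
          ∑ j, (b j : ℂ) * (ee (x.2 * y j) * kk (t j) x.1 x.2) with hF
  set Ψ : ℝ × ℝ → ℂ := fun x => ee (x.2 * c) * (x.2 : ℂ) * (p (x.1 + x.2) * q (ρ * x.2)) with hΨ
  have mF : Measurable F := by
    have hem := hce.measurable
    rw [hF]
    refine Measurable.add (by fun_prop) (Finset.measurable_sum _ fun j _ => by fun_prop)
  have mΨ : Measurable Ψ := Continuous.measurable (by fun_prop)
  have hpos : ∀ᵐ x : ℝ × ℝ, 0 < |x.1| ^ (-γ) * |x.2| ^ e := by
    have ae0 : ∀ᵐ u : ℝ, u ≠ 0 := by simp [ae_iff]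
    have h1 : ∀ᵐ x : ℝ × ℝ, x.1 ≠ 0 := Measure.quasiMeasurePreserving_fst.ae ae0
    have h2 : ∀ᵐ x : ℝ × ℝ, x.2 ≠ 0 := Measure.quasiMeasurePreserving_snd.ae ae0
    filter_upwards [h1, h2] with x h1 h2
    have := abs_pos.2 h1
    have := abs_pos.2 h2
    positivity
  have hcs := cs_weight volume F Ψ (fun x => |x.1| ^ (-γ) * |x.2| ^ e) mF mΨ (by fun_prop) hpos
  -- the pairing
  have tv := fun t' y' ht' => term_value p q ψ φ hψc hψ hφ ρ hρ t' y' ht'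
  have ti := fun t' y' ht' => integrable_term p q ρ hρ t' y' ht'
  have hFΨ : ∀ x, F x * Ψ x =
      (ee (x.2 * (y0 + c)) * mm t0 x.1 x.2) * (p (x.1 + x.2) * q (ρ * x.2)) +
      ∑ j, (b j : ℂ) * ((ee (x.2 * (y j + c)) * mm (t j) x.1 x.2) * (p (x.1 + x.2) * q (ρ * x.2))) := by
    intro x
    simp only [hF, hΨ, add_mul, Finset.sum_mul, ← mm_eq]
    congr 1
    · rw [mul_add, ee_add]; ring
    · refine Finset.sum_congr rfl fun j _ => ?_
      rw [mul_add, ee_add]; ring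
  have hψsupp : ∀ s, ψ s ≠ 0 → 0 < s ∧ s < a/2 := by
    intro s hs
    by_contra hcon
    apply hs
    apply hψs
    by_contra hlt
    rw [not_le, abs_lt] at hlt
    exact hcon ⟨by linarith [hlt.1], by linarith [hlt.2]⟩
  have hInteg0 : ∀ j, ∫ s in (0:ℝ)..(t j), (ψ s : ℂ) *
        ((φ ((y j + c - t j) / ρ) : ℂ) - (φ ((y j + c + t j - 2 * s) / ρ) : ℂ)) = 0 := by
    intro j
    have h1 : φ ((y j + c - t j) / ρ) = 0 := by
      apply hφs
      rw [sub_zero, abs_div, abs_of_pos hρ, le_div_iff₀ hρ, one_mul]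
      refine (hsep j).trans (le_of_eq ?_)
      rw [abs_sub_comm]; congr 1; rw [hc]; ring
    have : ∀ s, (ψ s : ℂ) *
        ((φ ((y j + c - t j) / ρ) : ℂ) - (φ ((y j + c + t j - 2 * s) / ρ) : ℂ)) = 0 := by
      intro s
      by_cases hs : ψ s = 0
      · simp [hs]
      have := hψsupp s hs
      have h2 : φ ((y j + c + t j - 2 * s) / ρ) = 0 := by
        apply hφs
        rw [sub_zero, abs_div, abs_of_pos hρ, le_div_iff₀ hρ, one_mul]
        refine le_trans ?_ (le_abs_self _)
        have := (abs_le.1 (hy j)).1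
        have := ht j
        rw [hc]; linarith
      rw [h1, h2]; simp
    simp_rw [this]; simp
  have hval0 : ∫ s in (0:ℝ)..t0, (ψ s : ℂ) *
        ((φ ((y0 + c - t0) / ρ) : ℂ) - (φ ((y0 + c + t0 - 2 * s) / ρ) : ℂ)) = (m : ℂ) := by
    have h1 : φ ((y0 + c - t0) / ρ) = 1 := by
      have : (y0 + c - t0) / ρ = 0 := by rw [hc]; ring
      rw [this, hφ1]
    have : ∀ s, (ψ s : ℂ) *
        ((φ ((y0 + c - t0) / ρ) : ℂ) - (φ ((y0 + c + t0 - 2 * s) / ρ) : ℂ)) = ((ψ s : ℝ) : ℂ) := by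
      intro s
      by_cases hs : ψ s = 0
      · simp [hs]
      have := hψsupp s hs
      have h2 : φ ((y0 + c + t0 - 2 * s) / ρ) = 0 := by
        apply hφs
        rw [sub_zero, abs_div, abs_of_pos hρ, le_div_iff₀ hρ, one_mul]
        refine le_trans ?_ (le_abs_self _)
        rw [hc]; linarith
      rw [h1, h2]; simp
    simp_rw [this]
    rw [intervalIntegral.integral_ofReal]
    congr 1
    rw [hm, ← intervalIntegral.integral_add_adjacent_intervals (a := 0) (b := a) (c := t0)
      (hψc.intervalIntegrable _ _) (hψc.intervalIntegrable _ _)]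
    have : ∫ s in a..t0, ψ s = 0 := by
      refine (intervalIntegral.integral_congr (g := fun _ => 0) fun s hs => ?_).trans (by simp)
      rw [uIcc_of_le ht0] at hs
      by_contra h
      have := hψsupp s h
      linarith [hs.1]
    rw [this, add_zero]
  have hpair : ∫ x, F x * Ψ x = (1 / (2 * Complex.I)) * ((1/ρ : ℝ) : ℂ) * (m : ℂ) := by
    simp_rw [hFΨ]
    rw [integral_add (ti t0 (y0 + c) (by linarith)) (integrable_finsetSum _ fun j _ =>
      (ti (t j) (y j + c) (by linarith [ht j])).const_mul _), integral_finsetSum _ fun j _ =>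
      (ti (t j) (y j + c) (by linarith [ht j])).const_mul _, tv t0 _ (by linarith), hval0]
    rw [Finset.sum_eq_zero, add_zero]
    intro j _
    rw [integral_const_mul, tv (t j) _ (by linarith [ht j]), hInteg0]; simp
  have hnorm : ‖∫ x, F x * Ψ x‖ ^ 2 = (m / 2) ^ 2 * ρ ^ (-2:ℝ) := by
    rw [hpair]
    simp only [norm_mul, norm_div, norm_one, Complex.norm_I, Complex.norm_real, Real.norm_eq_abs,
      abs_of_pos hρ, abs_of_pos hmpos, RCLike.norm_ofNat, mul_one, abs_one]
    rw [Real.rpow_neg hρ.le, Real.rpow_two]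
    field_simp
  rw [hnorm] at hcs
  have hK2 := hcs.trans (mul_le_mul_right (hKb ρ hρ hρa c) _)
  have hKp : 0 < K * ρ ^ (-3 - γ + e) := by positivity
  have h5 : (m / 2) ^ 2 / K * ρ ^ (γ + 1 - e) = ((m / 2) ^ 2 * ρ ^ (-2:ℝ)) / (K * ρ ^ (-3 - γ + e)) := by
    have : ρ ^ (-2:ℝ) = ρ ^ (γ + 1 - e) * ρ ^ (-3 - γ + e) := by
      rw [← Real.rpow_add hρ]; congr 1; ring
    rw [this]; field_simp
  rw [h5, ENNReal.ofReal_div_of_pos hKp]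
  exact ENNReal.div_le_of_le_mul hK2


lemma lint_dil {E : Type*} [NormedAddCommGroup E] [NormedSpace ℝ E] [MeasurableSpace E]
    [BorelSpace E] [FiniteDimensional ℝ E] (μ : Measure E) [μ.IsAddHaarMeasure]
    (f : E → ℝ≥0∞) (r : ℝ) (hr : r ≠ 0) :
    ∫⁻ x, f (r • x) ∂μ = ENNReal.ofReal (|(r ^ Module.finrank ℝ E)⁻¹|) * ∫⁻ x, f x ∂μ := by
  have h := Measure.map_addHaar_smul μ hr
  have e : MeasurableEmbedding (fun u : E => r • u) :=
    (Homeomorph.smulOfNeZero r hr).measurableEmbedding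
  have := e.lintegral_map f (μ := μ)
  rw [← this]
  change ∫⁻ a, f a ∂(Measure.map (r • ·) μ) = _
  rw [h, lintegral_smul_measure]
  rfl

lemma slicing (N : ℕ) (hN : 1 ≤ N) (f : EuclideanSpace ℝ (Fin N) → ℝ≥0∞) (hf : Measurable f)
    (B : Set (EuclideanSpace ℝ (Fin N))) (hB : MeasurableSet B)
    (hB2 : ∀ v ∈ B, 1 ≤ ‖v‖ ∧ ‖v‖ ≤ 2) :
    ∫⁻ v in B, ∫⁻ l : ℝ, ENNReal.ofReal (|l| ^ (N - 1 : ℝ)) * f (l • v) ≤ 4 * ∫⁻ ξ, f ξ := by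
  have ae0 : ∀ᵐ u : ℝ, u ≠ 0 := by simp [ae_iff]
  have : Nonempty (Fin N) := ⟨⟨0, hN⟩⟩
  have ae1 : ∀ᵐ ξ : EuclideanSpace ℝ (Fin N), ξ ≠ 0 := by simp [ae_iff]
  rw [lintegral_lintegral_swap (by
    have : Measurable (Function.uncurry fun (v : EuclideanSpace ℝ (Fin N)) (l : ℝ) =>
      ENNReal.ofReal (|l| ^ (N - 1 : ℝ)) * f (l • v)) := by
        unfold Function.uncurry; fun_prop
    exact this.aemeasurable)]
  set S : Set (ℝ × EuclideanSpace ℝ (Fin N)) := {p | |p.1| ≤ ‖p.2‖ ∧ ‖p.2‖ ≤ 2 * |p.1|} with hS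
  have mS : MeasurableSet S := by
    have m1 : MeasurableSet {p : ℝ × EuclideanSpace ℝ (Fin N) | |p.1| ≤ ‖p.2‖} :=
      measurableSet_le (by fun_prop) (by fun_prop)
    have m2 : MeasurableSet {p : ℝ × EuclideanSpace ℝ (Fin N) | ‖p.2‖ ≤ 2 * |p.1|} :=
      measurableSet_le (by fun_prop) (by fun_prop)
    exact m1.inter m2
  have h1 : ∀ l : ℝ, l ≠ 0 → ∫⁻ v in B, ENNReal.ofReal (|l| ^ (N - 1 : ℝ)) * f (l • v) ≤
      ∫⁻ ξ, S.indicator (fun p => ENNReal.ofReal (|p.1|⁻¹) * f p.2) (l, ξ) := by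
    intro l hl
    have hl' : 0 < |l| := abs_pos.2 hl
    have h2 := lint_dil volume (fun ξ => ENNReal.ofReal (|l| ^ (N - 1 : ℝ)) *
      S.indicator (fun p => f p.2) (l, ξ)) l hl
    calc _ ≤ ∫⁻ v, ENNReal.ofReal (|l| ^ (N - 1 : ℝ)) * S.indicator (fun p => f p.2) (l, l • v) := by
          rw [← lintegral_indicator hB]
          refine lintegral_mono fun v => ?_
          by_cases hv : v ∈ B
          · rw [indicator_of_mem hv, indicator_of_mem]
            have := hB2 v hv
            simp only [hS, mem_ofPred_eq, norm_smul, Real.norm_eq_abs]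
            constructor <;> nlinarith
          · rw [indicator_of_notMem hv]; exact zero_le
      _ = _ := by
          rw [h2, ← lintegral_const_mul']
          swap
          · exact ENNReal.ofReal_ne_top
          congr 1; ext ξ
          by_cases hx : (l, ξ) ∈ S
          · rw [indicator_of_mem hx, indicator_of_mem hx, ← mul_assoc,
              ← ENNReal.ofReal_mul (by positivity)]
            congr 2
            rw [finrank_euclideanSpace_fin, abs_inv, abs_pow, Real.rpow_sub hl', Real.rpow_natCast,
              Real.rpow_one]
            field_simp
          · rw [indicator_of_notMem hx, indicator_of_notMem hx]; simp
  calc _ ≤ ∫⁻ l : ℝ, ∫⁻ ξ, S.indicator (fun p => ENNReal.ofReal (|p.1|⁻¹) * f p.2) (l, ξ) := by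
        refine lintegral_mono_ae ?_
        filter_upwards [ae0] with l hl using h1 l hl
    _ = ∫⁻ ξ, ∫⁻ l : ℝ, S.indicator (fun p => ENNReal.ofReal (|p.1|⁻¹) * f p.2) (l, ξ) := by
        rw [lintegral_lintegral_swap]
        refine Measurable.aemeasurable ?_
        exact Measurable.indicator (by fun_prop) mS
    _ ≤ ∫⁻ ξ, 4 * f ξ := by
        refine lintegral_mono_ae ?_
        filter_upwards [ae1] with ξ hξ
        have hξ' : 0 < ‖ξ‖ := norm_pos_iff.2 hξ
        calc _ ≤ ∫⁻ l : ℝ, (Icc (-‖ξ‖) ‖ξ‖).indicator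
              (fun _ => ENNReal.ofReal (2 / ‖ξ‖) * f ξ) l := by
              refine lintegral_mono fun l => ?_
              by_cases hx : (l, ξ) ∈ S
              · have hx' := hx
                simp only [hS, mem_ofPred_eq] at hx'
                rw [indicator_of_mem hx, indicator_of_mem (by
                  exact abs_le.1 hx'.1)]
                gcongr
                have : 0 < |l| := by linarith [hx'.2]
                rw [inv_eq_one_div, div_le_div_iff₀ this hξ']
                linarith [hx'.2]
              · rw [indicator_of_notMem hx]; exact zero_le
          _ = _ := by
              rw [lintegral_indicator measurableSet_Icc, lintegral_const, Measure.restrict_apply_univ,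
                Real.volume_Icc, mul_right_comm, ← ENNReal.ofReal_mul (by positivity)]
              congr 1
              have : 2 / ‖ξ‖ * (‖ξ‖ - -‖ξ‖) = 4 := by field_simp; norm_num
              rw [this]; simp
    _ = _ := by rw [lintegral_const_mul _ hf]


noncomputable def lt' (N : ℕ) (v : EuclideanSpace ℝ (Fin N)) (z : ℝ × EuclideanSpace ℝ (Fin N)) : ℝ :=
  ‖v‖ * z.1 - inner ℝ z.2 v

lemma sum_split {n : ℕ} (k : Fin n) (b : Fin n → ℝ) (T : Fin n → ℂ) (hbk : b k = 1)
    (hb : ∀ j, k < j → b j = 0) :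
    ∑ i, (b i : ℂ) * T i = T k + ∑ j : {j : Fin n // j < k}, (b j.1 : ℂ) * T j.1 := by
  classical
  have h1 := Fintype.sum_subtype_add_sum_subtype (fun j : Fin n => j < k) (fun i => (b i : ℂ) * T i)
  rw [← h1, add_comm]
  congr 1
  have h2 : ∑ j : {j : Fin n // ¬ j < k}, (b j.1 : ℂ) * T j.1 = (b k : ℂ) * T k := by
    refine Fintype.sum_eq_single (⟨k, lt_irrefl k⟩ : {j : Fin n // ¬ j < k}) fun j hj => ?_
    have : k < j.1 := lt_of_le_of_ne (not_lt.1 j.2) (fun h => hj (Subtype.ext h.symm))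
    rw [hb _ this]; simp
  rw [h2, hbk]; simp

lemma ray_eq (N : ℕ) (H β : ℝ) {n : ℕ} (z : Fin n → ℝ × EuclideanSpace ℝ (Fin N))
    (b : Fin n → ℝ) (w : EuclideanSpace ℝ (Fin N)) (hw : ‖w‖ = 1) (u : ℝ) (hu : u ≠ 0) :
    ENNReal.ofReal (|u| ^ (N - 1 : ℝ)) * ∫⁻ τ : ℝ, ENNReal.ofReal
      (‖∑ i, (b i:ℂ) * Gker N (z i).1 (z i).2 τ (u • w)‖^2 * (|τ|^(1-2*H) * ‖u • w‖^(-β))) =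
    ∫⁻ τ : ℝ, ENNReal.ofReal (‖∑ i, (b i:ℂ) * (ee (u * inner ℝ (z i).2 w) * kk (z i).1 τ u)‖^2 *
      (|τ| ^ (-(2 * H - 1)) * |u| ^ (N - 1 - β : ℝ))) := by
  have hu' : 0 < |u| := abs_pos.2 hu
  rw [← lintegral_const_mul' _ _ ENNReal.ofReal_ne_top]
  have ae1 : ∀ᵐ τ : ℝ, τ ≠ |u| := by simp [ae_iff]
  have ae2 : ∀ᵐ τ : ℝ, τ ≠ -|u| := by simp [ae_iff]
  refine lintegral_congr_ae ?_
  filter_upwards [ae1, ae2] with τ h1 h2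
  have hn : ‖u • w‖ = |u| := by rw [norm_smul, hw, mul_one, Real.norm_eq_abs]
  rw [← ENNReal.ofReal_mul (by positivity)]
  congr 1
  have e1 : ∀ i, Gker N (z i).1 (z i).2 τ (u • w) = ee (u * inner ℝ (z i).2 w) * kk (z i).1 τ u := by
    intro i
    rw [Gker_eq_kk _ _ _ _ (by rw [hn]; exact hu'.ne')
      (by rw [hn]; intro h; exact h2 (by linarith)) (by rw [hn]; exact sub_ne_zero.2 h1), hn, kk_abs,
      inner_smul_right]
    rfl
  simp_rw [e1]
  rw [hn]
  have e2 : |u| ^ (N - 1 - β : ℝ) = |u| ^ (N - 1 : ℝ) * |u| ^ (-β) := by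
    rw [← Real.rpow_add hu']; rfl
  have e3 : -(2 * H - 1) = 1 - 2 * H := by ring
  rw [e2, e3]; ring

lemma var_ge (N : ℕ) (hN : 1 ≤ N) (H β a : ℝ) (ha : 0 < a) (hH1 : 1 / 2 ≤ H) (hH2 : H < 1)
    (hβlow : (N : ℝ) - 2 * H - 1 < β) :
    ∃ c : ℝ, 0 < c ∧ ∀ (n : ℕ) (z : Fin n → ℝ × EuclideanSpace ℝ (Fin N)) (k : Fin n) (b : Fin n → ℝ),
      b k = 1 → (∀ j, k < j → b j = 0) → (∀ i, a ≤ (z i).1) →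
      (∀ i j, ‖(z i).2 - (z j).2‖ ≤ a / 4) →
      ∀ (B : Set (EuclideanSpace ℝ (Fin N))), MeasurableSet B → (∀ v ∈ B, 1 ≤ ‖v‖ ∧ ‖v‖ ≤ 2) →
      ∀ ρ : EuclideanSpace ℝ (Fin N) → ℝ, (∀ v ∈ B, 0 ≤ ρ v) → (∀ v ∈ B, ρ v ≤ a / 2) →
      (∀ v ∈ B, ∀ j, j < k → 2 * ρ v ≤ |lt' N v (z j) - lt' N v (z k)|) →
      ENNReal.ofReal c * ∫⁻ v in B, ENNReal.ofReal (ρ v ^ (2 * alphaExp N H β)) ≤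
        ∫⁻ p : ℝ × EuclideanSpace ℝ (Fin N), ENNReal.ofReal
          (‖∑ i, (b i:ℂ) * Gker N (z i).1 (z i).2 p.1 p.2‖^2 * (|p.1|^(1-2*H) * ‖p.2‖^(-β))) := by
  obtain ⟨c, hc, hcb⟩ := slnd_one a (2 * H - 1) (N - 1 - β) ha (by linarith) (by linarith) (by linarith)
  refine ⟨c * (1/2) * (1/2) ^ (N - 1 : ℝ) * (1/4), by positivity, ?_⟩
  intro n z k b hbk hb hza hzx B mB hB ρ hρ0 hρa hρ
  set g : ℝ × EuclideanSpace ℝ (Fin N) → ℝ≥0∞ := fun p => ENNReal.ofReal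
    (‖∑ i, (b i:ℂ) * Gker N (z i).1 (z i).2 p.1 p.2‖^2 * (|p.1|^(1-2*H) * ‖p.2‖^(-β))) with hg
  have mg : Measurable g := by
    have := fun i => measurable_Gker N (z i).1 (z i).2
    have : Measurable fun p : ℝ × EuclideanSpace ℝ (Fin N) =>
      ∑ i, (b i:ℂ) * Gker N (z i).1 (z i).2 p.1 p.2 :=
      Finset.measurable_sum _ fun i _ => (this i).const_mul _
    fun_prop
  set f : EuclideanSpace ℝ (Fin N) → ℝ≥0∞ := fun ξ => ∫⁻ τ, g (τ, ξ) with hf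
  have mf : Measurable f := Measurable.lintegral_prod_left' mg
  have hN1 : (0:ℝ) ≤ N - 1 := by
    have : (1:ℝ) ≤ N := by exact_mod_cast hN
    linarith
  have h2α : 2 * H - 1 + 1 - (N - 1 - β) = 2 * alphaExp N H β := by unfold alphaExp; ring
  have h2αpos : 0 < 2 * alphaExp N H β := by unfold alphaExp; linarith
  have hsl := slicing N hN f mf B mB hB
  have key : ∀ v ∈ B, ENNReal.ofReal (c * (1/2) * (1/2) ^ (N - 1 : ℝ)) *
      ENNReal.ofReal (ρ v ^ (2 * alphaExp N H β)) ≤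
      ∫⁻ l : ℝ, ENNReal.ofReal (|l| ^ (N - 1 : ℝ)) * f (l • v) := by
    intro v hv
    have hv1 := (hB v hv).1
    have hv2 := (hB v hv).2
    have hv0 : 0 < ‖v‖ := by linarith
    rcases (hρ0 v hv).eq_or_lt with h0 | h0
    · rw [← h0, Real.zero_rpow h2αpos.ne']; simp
    set w := ‖v‖⁻¹ • v with hw
    have hw1 : ‖w‖ = 1 := by rw [hw, norm_smul, norm_inv, norm_norm]; field_simp
    have hiw : ∀ x : EuclideanSpace ℝ (Fin N), inner ℝ x w = ‖v‖⁻¹ * inner ℝ x v := fun x => by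
      rw [hw, inner_smul_right]
    have hs := hcb {j : Fin n // j < k} inferInstance (fun j => (z j.1).1)
      (fun j => inner ℝ (z j.1).2 w) (fun j => b j.1) (z k).1 (inner ℝ (z k).2 w) (ρ v) (hza k)
      (fun j => hza j.1) (fun j => ?_) h0 (hρa v hv) (fun j => ?_)
    rotate_left
    · rw [← inner_sub_left]
      refine (abs_real_inner_le_norm _ _).trans ?_
      rw [hw1, mul_one]; exact hzx _ _
    · have h1 := hρ v hv j.1 j.2
      have h2 : (z j.1).1 - inner ℝ (z j.1).2 w - ((z k).1 - inner ℝ (z k).2 w) =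
        ‖v‖⁻¹ * (lt' N v (z j.1) - lt' N v (z k)) := by
        rw [hiw, hiw, lt', lt']; field_simp
      rw [h2, abs_mul, abs_of_pos (inv_pos.2 hv0)]
      rw [inv_mul_eq_div, le_div_iff₀ hv0]
      nlinarith
    rw [h2α] at hs
    have e1 : ∫⁻ l : ℝ, ENNReal.ofReal (|l| ^ (N - 1 : ℝ)) * f (l • v) =
        ENNReal.ofReal (‖v‖⁻¹) * ∫⁻ u : ℝ, ENNReal.ofReal (|‖v‖⁻¹ * u| ^ (N - 1 : ℝ)) * f (u • w) := by
      rw [← lint_scale (fun u => ENNReal.ofReal (|‖v‖⁻¹ * u| ^ (N - 1 : ℝ)) * f (u • w)) ‖v‖ hv0]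
      congr 1; ext l
      have a1 : ‖v‖⁻¹ * (‖v‖ * l) = l := by field_simp
      have a2 : (‖v‖ * l) • w = l • v := by
        rw [hw, smul_smul]; congr 1; field_simp
      rw [a1, a2]
    have ae0 : ∀ᵐ u : ℝ, u ≠ 0 := by simp [ae_iff]
    have e2 : ∫⁻ u : ℝ, ENNReal.ofReal (|u| ^ (N - 1 : ℝ)) * f (u • w) =
        ∫⁻ x : ℝ × ℝ, ENNReal.ofReal (‖ee (x.2 * inner ℝ (z k).2 w) * kk (z k).1 x.1 x.2 +
          ∑ j : {j : Fin n // j < k}, (b j.1 : ℂ) * (ee (x.2 * inner ℝ (z j.1).2 w) *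
            kk (z j.1).1 x.1 x.2)‖ ^ 2 * (|x.1| ^ (-(2 * H - 1)) * |x.2| ^ (N - 1 - β : ℝ))) := by
      rw [Measure.volume_eq_prod, lintegral_prod_symm]
      · refine lintegral_congr_ae ?_
        filter_upwards [ae0] with u hu
        simp only [hf, hg]
        rw [ray_eq N H β z b w hw1 u hu]
        congr 1; ext τ
        rw [sum_split k b _ hbk hb]
      · refine Measurable.aemeasurable ?_
        have hkm := measurable_kk
        have hem := continuous_ee.measurable
        have : Measurable fun x : ℝ × ℝ => ee (x.2 * inner ℝ (z k).2 w) * kk (z k).1 x.1 x.2 +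
          ∑ j : {j : Fin n // j < k}, (b j.1 : ℂ) * (ee (x.2 * inner ℝ (z j.1).2 w) *
            kk (z j.1).1 x.1 x.2) :=
          Measurable.add (by fun_prop) (Finset.measurable_sum _ fun j _ => by fun_prop)
        fun_prop
    rw [← e2] at hs
    rw [e1]
    calc _ = ENNReal.ofReal (1/2) * (ENNReal.ofReal ((1/2) ^ (N - 1 : ℝ)) *
            ENNReal.ofReal (c * ρ v ^ (2 * alphaExp N H β))) := by
          have : 0 ≤ ρ v ^ (2 * alphaExp N H β) := Real.rpow_nonneg h0.le _
          rw [← ENNReal.ofReal_mul (by positivity), ← ENNReal.ofReal_mul (by positivity),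
            ← ENNReal.ofReal_mul (by positivity)]
          congr 1; ring
      _ ≤ ENNReal.ofReal (1/2) * (ENNReal.ofReal ((1/2) ^ (N - 1 : ℝ)) *
            ∫⁻ u : ℝ, ENNReal.ofReal (|u| ^ (N - 1 : ℝ)) * f (u • w)) := by gcongr
      _ ≤ _ := by
          have hv3 : 1/2 ≤ ‖v‖⁻¹ := by
            rw [inv_eq_one_div, div_le_div_iff₀ (by norm_num) hv0]; linarith
          rw [← lintegral_const_mul' _ _ ENNReal.ofReal_ne_top]
          refine mul_le_mul' (ENNReal.ofReal_le_ofReal hv3) (lintegral_mono fun u => ?_)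
          rw [← mul_assoc, ← ENNReal.ofReal_mul (by positivity), abs_mul,
            Real.mul_rpow (abs_nonneg _) (abs_nonneg _), abs_of_pos (inv_pos.2 hv0)]
          gcongr
  have e3 : ∫⁻ p, g p = ∫⁻ ξ, f ξ := by
    rw [Measure.volume_eq_prod, lintegral_prod_symm _ mg.aemeasurable]
  rw [e3]
  have h4 : ENNReal.ofReal (c * (1/2) * (1/2) ^ (N - 1 : ℝ)) *
      ∫⁻ v in B, ENNReal.ofReal (ρ v ^ (2 * alphaExp N H β)) ≤ 4 * ∫⁻ ξ, f ξ := by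
    rw [← lintegral_const_mul' _ _ ENNReal.ofReal_ne_top]
    refine le_trans (setLIntegral_mono' mB key) hsl
  calc _ = ENNReal.ofReal (1/4) * (ENNReal.ofReal (c * (1/2) * (1/2) ^ (N - 1 : ℝ)) *
      ∫⁻ v in B, ENNReal.ofReal (ρ v ^ (2 * alphaExp N H β))) := by
        rw [← mul_assoc, ← ENNReal.ofReal_mul (by positivity)]; congr 2; ring
    _ ≤ ENNReal.ofReal (1/4) * (4 * ∫⁻ ξ, f ξ) := by gcongr
    _ = _ := by
        rw [← mul_assoc]
        have : ENNReal.ofReal (1/4) * 4 = 1 := by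
          have : (4:ℝ≥0∞) = ENNReal.ofReal 4 := by simp
          rw [this, ← ENNReal.ofReal_mul (by norm_num)]; norm_num
        rw [this, one_mul]


noncomputable def Gmm {X ι J : Type*} (L : X → ι → ℝ) (w : J → X) (z : X) : ℝ≥0∞ :=
  ⨆ i, ⨅ j, ENNReal.ofReal |L z i - L (w j) i|

lemma ball_int {E : Type*} [NormedAddCommGroup E] [NormedSpace ℝ E] [MeasurableSpace E]
    [BorelSpace E] [FiniteDimensional ℝ E] [Nontrivial E] (μ : Measure E) [μ.IsAddHaarMeasure]
    (s : ℝ) (hs0 : 0 < s) (hs : s < Module.finrank ℝ E) :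
    ∃ A : ℝ, 0 ≤ A ∧ ∀ ρ : ℝ, 0 < ρ →
      ∫⁻ x, (Metric.ball (0:E) ρ).indicator (fun x => ENNReal.ofReal ‖x‖ ^ (-s)) x ∂μ ≤
        ENNReal.ofReal (A * ρ ^ (Module.finrank ℝ E - s)) := by
  set A := ∫⁻ x, (Metric.ball (0:E) 1).indicator (fun x => ENNReal.ofReal ‖x‖ ^ (-s)) x ∂μ with hA
  have fA : A < ∞ := by
    rw [hA, lintegral_indicator measurableSet_ball]
    refine lt_of_le_of_lt (le_of_eq ?_) (lint_norm_rpow_ball μ s 1 one_pos hs)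
    refine lintegral_congr_ae (ae_restrict_of_ae ?_)
    have ae1 : ∀ᵐ ξ : E ∂μ, ξ ≠ 0 := by simp [ae_iff]
    filter_upwards [ae1] with x hx
    rw [ENNReal.ofReal_rpow_of_pos (norm_pos_iff.2 hx)]
  refine ⟨A.toReal, ENNReal.toReal_nonneg, fun ρ hρ => ?_⟩
  set f : E → ℝ≥0∞ := (Metric.ball (0:E) ρ).indicator (fun x => ENNReal.ofReal ‖x‖ ^ (-s)) with hf
  have h1 := lint_dil μ f ρ hρ.ne'
  have h2 : ∀ x, f (ρ • x) = ENNReal.ofReal (ρ ^ (-s)) *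
      (Metric.ball (0:E) 1).indicator (fun x => ENNReal.ofReal ‖x‖ ^ (-s)) x := by
    intro x
    have hiff : ρ • x ∈ Metric.ball (0:E) ρ ↔ x ∈ Metric.ball (0:E) 1 := by
      rw [mem_ball_zero_iff, mem_ball_zero_iff, norm_smul, Real.norm_eq_abs, abs_of_pos hρ]
      constructor
      · intro h; by_contra h'; push Not at h'; nlinarith
      · intro h; nlinarith
    by_cases hx : x ∈ Metric.ball (0:E) 1
    · rw [hf, indicator_of_mem (hiff.2 hx), indicator_of_mem hx, norm_smul, Real.norm_eq_abs,
        abs_of_pos hρ, ENNReal.ofReal_mul hρ.le, ← ENNReal.ofReal_rpow_of_pos hρ]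
      exact ENNReal.mul_rpow_of_ne_top ENNReal.ofReal_ne_top ENNReal.ofReal_ne_top _
    · rw [hf, indicator_of_notMem (fun h => hx (hiff.1 h)), indicator_of_notMem hx, mul_zero]
  simp_rw [h2] at h1
  rw [lintegral_const_mul' _ _ ENNReal.ofReal_ne_top, ← hA] at h1
  have h3 : ∫⁻ x, f x ∂μ = ENNReal.ofReal (ρ ^ Module.finrank ℝ E) * (ENNReal.ofReal (ρ ^ (-s)) * A) := by
    rw [h1, ← mul_assoc, ← ENNReal.ofReal_mul (by positivity), abs_of_pos (by positivity),
      mul_inv_cancel₀ (by positivity)]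
    simp
  rw [h3, ← ENNReal.ofReal_toReal fA.ne, ← ENNReal.ofReal_mul (by positivity),
    ← ENNReal.ofReal_mul (by positivity), ENNReal.toReal_ofReal ENNReal.toReal_nonneg]
  refine ENNReal.ofReal_le_ofReal (le_of_eq ?_)
  rw [Real.rpow_sub hρ, Real.rpow_neg hρ.le, Real.rpow_natCast]
  field_simp

lemma Gmm_ge {X ι J : Type*} [NormedAddCommGroup X] [NormedSpace ℝ X] [Finite ι] [Finite J]
    [Nonempty J] (L : X →ₗ[ℝ] (ι → ℝ)) (K : ℝ) (hK : 0 < K)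
    (hL : ∀ z M, (∀ i, |L z i| ≤ M) → ‖z‖ ≤ K * M) (w : J → X)
    (y : (ι → J) → X) (hy : ∀ σ i, L (y σ) i = L (w (σ i)) i) (s : ℝ) (hs : 0 < s) (z : X) :
    ∃ σ : ι → J, (Gmm L w z) ^ (-s) ≤ ENNReal.ofReal (K ^ s) * ENNReal.ofReal ‖z - y σ‖ ^ (-s) := by
  have := fun i => exists_eq_ciInf_of_finite (f := fun j => ENNReal.ofReal |L z i - L (w j) i|)
  choose σ hσ using this
  refine ⟨σ, ?_⟩
  have h1 : ∀ i, ENNReal.ofReal |L (z - y σ) i| ≤ Gmm L w z := by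
    intro i
    rw [map_sub, Pi.sub_apply, hy, hσ]
    exact le_iSup (fun i => ⨅ j, ENNReal.ofReal |L z i - L (w j) i|) i
  by_cases htop : Gmm L w z = ∞
  · rw [htop, ENNReal.top_rpow_of_neg (by linarith)]; exact zero_le
  have h2 : ‖z - y σ‖ ≤ K * (Gmm L w z).toReal := by
    apply hL
    intro i
    exact (ENNReal.ofReal_le_iff_le_toReal htop).1 (h1 i)
  have h3 : ENNReal.ofReal ‖z - y σ‖ ≤ ENNReal.ofReal K * Gmm L w z := by
    rw [← ENNReal.ofReal_toReal htop, ← ENNReal.ofReal_mul hK.le]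
    exact ENNReal.ofReal_le_ofReal h2
  have h4 := ENNReal.rpow_le_rpow h3 hs.le
  rw [ENNReal.mul_rpow_of_nonneg _ _ hs.le] at h4
  rw [ENNReal.rpow_neg, ENNReal.rpow_neg, ← ENNReal.ofReal_rpow_of_pos hK]
  have hKs0 : ENNReal.ofReal K ^ s ≠ 0 := by
    rw [ENNReal.ofReal_rpow_of_pos hK]; simp; positivity
  have hKst : ENNReal.ofReal K ^ s ≠ ∞ := ENNReal.rpow_ne_top_of_nonneg hs.le ENNReal.ofReal_ne_top
  calc _ = ENNReal.ofReal K ^ s * (ENNReal.ofReal K ^ s * Gmm L w z ^ s)⁻¹ := by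
        rw [ENNReal.mul_inv (Or.inl hKs0) (Or.inl hKst), ← mul_assoc,
          ENNReal.mul_inv_cancel hKs0 hKst, one_mul]
    _ ≤ _ := by gcongr

lemma step_int {X : Type*} [NormedAddCommGroup X] [NormedSpace ℝ X] [MeasurableSpace X]
    [BorelSpace X] [FiniteDimensional ℝ X] [Nontrivial X] (μ : Measure X) [μ.IsAddHaarMeasure]
    (ι : Type) [Fintype ι] (hcard : Fintype.card ι = Module.finrank ℝ X)
    (s K : ℝ) (hs0 : 0 < s) (hs : s < Module.finrank ℝ X) (hK : 0 < K) :
    ∃ C : ℝ, 0 < C ∧ ∀ (L : X →ₗ[ℝ] (ι → ℝ)), (∀ z M, (∀ i, |L z i| ≤ M) → ‖z‖ ≤ K * M) →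
      ∀ (k : ℕ), 0 < k → ∀ (w : Fin k → X) (I : Set X) (V : ℝ), 0 < V → μ I = ENNReal.ofReal V →
      ∫⁻ z in I, (Gmm L w z) ^ (-s) ∂μ ≤
        ENNReal.ofReal (C * (k:ℝ) ^ s * V ^ (1 - s / Module.finrank ℝ X)) := by
  obtain ⟨A, hA0, hA⟩ := ball_int μ s hs0 hs
  refine ⟨K ^ s * (1 + A), by positivity, ?_⟩
  intro L hL k hk w I V hV hI
  set n := Module.finrank ℝ X with hn
  have hnpos : 0 < n := Module.finrank_pos
  have hnR : (0:ℝ) < n := by exact_mod_cast hnpos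
  have hkR : (0:ℝ) < k := by exact_mod_cast hk
  have : Nonempty (Fin k) := ⟨⟨0, hk⟩⟩
  have hinj : Function.Injective L := by
    rw [injective_iff_map_eq_zero]
    intro z hz
    have := hL z 0 (fun i => by rw [hz]; simp)
    rw [mul_zero] at this
    exact norm_le_zero_iff.1 this
  have hsurj : Function.Surjective L := by
    rw [← LinearMap.injective_iff_surjective_of_finrank_eq_finrank]
    · exact hinj
    · simp [hcard, ← hn]
  have : ∀ σ : ι → Fin k, ∃ y, ∀ i, L y i = L (w (σ i)) i := by
    intro σ
    obtain ⟨y, hy⟩ := hsurj (fun i => L (w (σ i)) i)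
    exact ⟨y, fun i => by rw [hy]⟩
  choose y hy using this
  set ρ := V ^ (1 / (n:ℝ)) / k with hρdef
  have hρ : 0 < ρ := by positivity
  set f : X → ℝ≥0∞ := (Metric.ball (0:X) ρ).indicator (fun x => ENNReal.ofReal ‖x‖ ^ (-s)) with hf
  have hmf : Measurable f := by
    refine Measurable.indicator ?_ measurableSet_ball
    fun_prop
  classical
  have hpt : ∀ z, (Gmm L w z) ^ (-s) ≤ ENNReal.ofReal (K ^ s) * (ENNReal.ofReal (ρ ^ (-s)) +
      ∑ σ : ι → Fin k, f (z - y σ)) := by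
    intro z
    obtain ⟨σ, hσ⟩ := Gmm_ge L K hK hL w y hy s hs0 z
    refine hσ.trans ?_
    gcongr
    by_cases hz : z - y σ ∈ Metric.ball (0:X) ρ
    · refine le_trans ?_ le_add_self
      refine le_trans (le_of_eq ?_) (Finset.single_le_sum (f := fun σ => f (z - y σ))
        (fun _ _ => zero_le) (Finset.mem_univ σ))
      simp only [hf, indicator_of_mem hz]
    · refine le_trans ?_ le_self_add
      rw [mem_ball_zero_iff, not_lt] at hz
      rw [← ENNReal.ofReal_rpow_of_pos hρ, ENNReal.rpow_neg, ENNReal.rpow_neg]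
      gcongr
  calc _ ≤ ∫⁻ z in I, ENNReal.ofReal (K ^ s) * (ENNReal.ofReal (ρ ^ (-s)) +
      ∑ σ : ι → Fin k, f (z - y σ)) ∂μ := lintegral_mono hpt
    _ = ENNReal.ofReal (K ^ s) * (ENNReal.ofReal (ρ ^ (-s)) * μ I +
        ∑ σ : ι → Fin k, ∫⁻ z in I, f (z - y σ) ∂μ) := by
        rw [lintegral_const_mul' _ _ ENNReal.ofReal_ne_top, lintegral_add_left (by fun_prop),
          lintegral_const, Measure.restrict_apply_univ, lintegral_finsetSum _ (fun σ _ => by fun_prop)]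
    _ ≤ ENNReal.ofReal (K ^ s) * (ENNReal.ofReal (ρ ^ (-s)) * ENNReal.ofReal V +
        ∑ σ : ι → Fin k, ENNReal.ofReal (A * ρ ^ (n - s))) := by
        rw [hI]
        gcongr with σ
        calc _ ≤ ∫⁻ z, f (z - y σ) ∂μ := setLIntegral_le_lintegral _ _
          _ = ∫⁻ z, f z ∂μ := lintegral_sub_right_eq_self f (y σ)
          _ ≤ _ := hA ρ hρ
    _ = ENNReal.ofReal (K ^ s * (ρ ^ (-s) * V + (k:ℝ) ^ n * (A * ρ ^ (n - s)))) := by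
        rw [Finset.sum_const, Finset.card_univ, Fintype.card_fun, Fintype.card_fin, hcard,
          nsmul_eq_mul, ← ENNReal.ofReal_natCast, ← ENNReal.ofReal_mul (by positivity),
          ← ENNReal.ofReal_mul (by positivity), ← ENNReal.ofReal_add (by positivity) (by positivity),
          ← ENNReal.ofReal_mul (by positivity)]
        push_cast; rfl
    _ = _ := by
        congr 1
        have e1 : ρ ^ (-s) * V = (k:ℝ) ^ s * V ^ (1 - s / n) := by
          rw [hρdef, Real.div_rpow (by positivity) (by positivity), ← Real.rpow_mul hV.le,
            Real.rpow_neg hkR.le, Real.rpow_sub hV, Real.rpow_one]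
          have : 1 / (n:ℝ) * -s = -(s / n) := by ring
          rw [this, Real.rpow_neg hV.le]
          field_simp
        have e2 : (k:ℝ) ^ n * ρ ^ (n - s) = (k:ℝ) ^ s * V ^ (1 - s / n) := by
          have : ρ ^ ((n:ℝ) - s) = ρ ^ (n:ℝ) * ρ ^ (-s) := by
            rw [← Real.rpow_add hρ]; rfl
          rw [this, ← e1]
          have : ρ ^ (n:ℝ) = V / (k:ℝ) ^ n := by
            rw [Real.rpow_natCast, hρdef, div_pow, ← Real.rpow_natCast, ← Real.rpow_mul hV.le]
            congr 1
            rw [one_div, inv_mul_cancel₀ hnR.ne', Real.rpow_one]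
          rw [this]; field_simp
        calc _ = K ^ s * (ρ ^ (-s) * V + A * ((k:ℝ) ^ n * ρ ^ (n - s))) := by ring
          _ = _ := by rw [e1, e2]; ring


lemma iter_int {X : Type*} [MeasurableSpace X] (ν : Measure X) [SigmaFinite ν]
    (h : (m : ℕ) → (Fin m → X) → X → ℝ≥0∞) (hmeas : ∀ m w, Measurable (h m w)) (M : ℕ → ℝ≥0∞)
    (hMt : ∀ m, M m ≠ ∞) (hM : ∀ m w, ∫⁻ x, h m w x ∂ν ≤ M m) (n : ℕ) :
    ∫⁻ z, ∏ k : Fin n, h k (fun j : Fin k => z (Fin.castLE k.2.le j)) (z k)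
      ∂(Measure.pi fun _ : Fin n => ν) ≤ ∏ k : Fin n, M k := by
  induction n with
  | zero => 
    simp only [Finset.univ_eq_empty, Finset.prod_empty, lintegral_const, one_mul]
    rw [Measure.pi_univ]; simp
  | succ n ih =>
    set P : (Fin n → X) → ℝ≥0∞ := fun z' =>
      ∏ k : Fin n, h k (fun j : Fin k => z' (Fin.castLE k.2.le j)) (z' k) with hP
    have hmp := measurePreserving_piFinSuccAbove (fun _ : Fin (n+1) => ν) (Fin.last n)
    set g : X × (Fin n → X) → ℝ≥0∞ := fun p => P p.2 * h n p.2 p.1 with hg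
    have h1 : ∀ z : Fin (n+1) → X,
        ∏ k : Fin (n+1), h k (fun j : Fin k => z (Fin.castLE k.2.le j)) (z k) =
        g (MeasurableEquiv.piFinSuccAbove (fun _ => X) (Fin.last n) z) := by
      intro z
      rw [Fin.prod_univ_castSucc]
      simp only [hg, hP, MeasurableEquiv.piFinSuccAbove_apply, Fin.insertNthEquiv, Equiv.coe_fn_symm_mk]
      congr 1
      · refine Finset.prod_congr rfl fun k _ => ?_
        simp only [Fin.removeNth, Fin.succAbove_last]
        rfl
      · have e : (Fin.last n).removeNth z = fun i => z i.castSucc := by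
          funext i; simp [Fin.removeNth]
        rw [e]
        rfl
    simp_rw [h1]
    rw [hmp.lintegral_comp_emb (MeasurableEquiv.measurableEmbedding _) g]
    have h2 := (Measure.measurePreserving_swap (μ := Measure.pi fun _ : Fin n => ν) (ν := ν)).lintegral_comp_emb
      (MeasurableEquiv.prodComm.measurableEmbedding) g
    rw [← h2]
    calc _ ≤ ∫⁻ z', ∫⁻ x, g (x, z') ∂ν ∂(Measure.pi fun _ : Fin n => ν) := lintegral_prod_le _
      _ ≤ ∫⁻ z', P z' * M n ∂(Measure.pi fun _ : Fin n => ν) := by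
          refine lintegral_mono fun z' => ?_
          simp only [hg]
          rw [lintegral_const_mul _ (hmeas n z')]
          gcongr
          exact hM n z'
      _ ≤ _ := by
          rw [lintegral_mul_const' _ _ (hMt n), Fin.prod_univ_castSucc]
          gcongr
          · exact ih
          · simp

lemma jensen_neg {X : Type*} [MeasurableSpace X] (μ : Measure X) (f : X → ℝ≥0∞) (hf : Measurable f)
    (r : ℝ) (hr : 0 < r) :
    (μ univ) ^ (1 + r) * (∫⁻ x, f x ∂μ) ^ (-r) ≤ ∫⁻ x, f x ^ (-r) ∂μ := by
  by_cases h1 : ∫⁻ x, f x ∂μ = ∞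
  · rw [h1, ENNReal.top_rpow_of_neg (by linarith)]; simp
  by_cases h2 : ∫⁻ x, f x ^ (-r) ∂μ = ∞
  · rw [h2]; exact le_top
  have a1 := ae_lt_top hf h1
  have a2 := ae_lt_top (hf.pow_const (-r)) h2
  have hr1 : 0 < 1 + r := by linarith
  have hold := ENNReal.lintegral_mul_le_Lp_mul_Lq μ (p := (1 + r) / r) (q := 1 + r)
    (by
      rw [Real.holderConjugate_iff]
      constructor
      · rw [lt_div_iff₀ hr]; linarith
      · field_simp
        ring)
    (f := fun x => f x ^ (r / (1 + r))) (g := fun x => f x ^ (-(r / (1 + r))))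
    (by fun_prop) (by fun_prop)
  have e0 : ∫⁻ x, ((fun x => f x ^ (r / (1 + r))) * (fun x => f x ^ (-(r / (1 + r))))) x ∂μ = μ univ := by
    rw [← lintegral_one]
    refine lintegral_congr_ae ?_
    filter_upwards [a1, a2] with x h1 h2
    have h0 : f x ≠ 0 := by
      intro h0
      rw [h0, ENNReal.zero_rpow_of_neg (by linarith)] at h2
      exact lt_irrefl _ h2
    simp only [Pi.mul_apply]
    rw [← ENNReal.rpow_add _ _ h0 h1.ne]; simp
  have e1 : ∀ x, (f x ^ (r / (1 + r))) ^ ((1 + r) / r) = f x := by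
    intro x
    rw [← ENNReal.rpow_mul]
    have : r / (1 + r) * ((1 + r) / r) = 1 := by field_simp
    rw [this, ENNReal.rpow_one]
  have e2 : ∀ x, (f x ^ (-(r / (1 + r)))) ^ (1 + r) = f x ^ (-r) := by
    intro x
    rw [← ENNReal.rpow_mul]
    congr 1; field_simp
  rw [e0] at hold
  simp_rw [e1, e2] at hold
  have h3 := ENNReal.rpow_le_rpow hold hr1.le
  rw [ENNReal.mul_rpow_of_nonneg _ _ hr1.le, ← ENNReal.rpow_mul, ← ENNReal.rpow_mul] at h3
  have x1 : 1 / ((1 + r) / r) * (1 + r) = r := by field_simp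
  have x2 : 1 / (1 + r) * (1 + r) = 1 := by field_simp
  rw [x1, x2, ENNReal.rpow_one] at h3
  by_cases h4 : ∫⁻ x, f x ∂μ = 0
  · rw [h4, ENNReal.zero_rpow_of_pos hr, zero_mul] at h3
    have : μ univ = 0 := by
      have := le_antisymm h3 zero_le
      rw [ENNReal.rpow_eq_zero_iff] at this
      rcases this with h | h
      · exact h.1
      · linarith [h.2]
    rw [this, ENNReal.zero_rpow_of_pos hr1]; simp
  · have h5 : (∫⁻ x, f x ∂μ) ^ r ≠ 0 := by
      intro h; rw [ENNReal.rpow_eq_zero_iff] at h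
      rcases h with h | h
      · exact h4 h.1
      · exact h1 h.1
    have h6 : (∫⁻ x, f x ∂μ) ^ r ≠ ∞ := ENNReal.rpow_ne_top_of_nonneg hr.le h1
    rw [ENNReal.rpow_neg, ← div_eq_mul_inv]
    refine ENNReal.div_le_of_le_mul ?_
    rw [mul_comm]; exact h3

noncomputable def dirs (N : ℕ) (hN : 1 ≤ N) : Option (Fin N) → EuclideanSpace ℝ (Fin N)
  | some i => EuclideanSpace.single i (3/2 : ℝ)
  | none => EuclideanSpace.single ⟨0, hN⟩ (-(3/2) : ℝ)

lemma norm_dirs (N : ℕ) (hN : 1 ≤ N) (i) : ‖dirs N hN i‖ = 3/2 := by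
  cases i <;> simp [dirs, abs_of_pos]

lemma lt'_sub (N : ℕ) (v : EuclideanSpace ℝ (Fin N)) (z w) :
    lt' N v z - lt' N v w = lt' N v (z - w) := by
  simp only [lt', Prod.fst_sub, Prod.snd_sub, inner_sub_left]; ring

lemma abs_lt'_le (N : ℕ) (v : EuclideanSpace ℝ (Fin N)) (z) :
    |lt' N v z| ≤ ‖v‖ * (|z.1| + ‖z.2‖) := by
  unfold lt'
  refine (abs_sub _ _).trans ?_
  have := abs_real_inner_le_norm z.2 v
  rw [abs_mul, abs_norm]
  nlinarith

lemma dir_bound (N : ℕ) (hN : 1 ≤ N) (v : EuclideanSpace ℝ (Fin N)) (hv : ‖v‖ ≤ 1 / (8 * N))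
    (z : ℝ × EuclideanSpace ℝ (Fin N)) (M : ℝ)
    (hM : ∀ i, |lt' N (dirs N hN i + v) z| ≤ M) : ‖z‖ ≤ 2 * N * M := by
  have hNR : (1:ℝ) ≤ N := by exact_mod_cast hN
  obtain ⟨t, x⟩ := z
  set Z := ‖((t, x) : ℝ × EuclideanSpace ℝ (Fin N))‖ with hZ
  have ht : |t| ≤ Z := norm_fst_le (t, x)
  have hx : ‖x‖ ≤ Z := norm_snd_le (t, x)
  have hZ0 : 0 ≤ Z := norm_nonneg _
  set M' := M + Z / (4 * N) with hM'
  have h1 : ∀ i, |lt' N (dirs N hN i) (t, x)| ≤ M' := by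
    intro i
    have e : lt' N (dirs N hN i) (t, x) = lt' N (dirs N hN i + v) (t, x) -
      ((‖dirs N hN i + v‖ - ‖dirs N hN i‖) * t - inner ℝ x v) := by
      simp only [lt', inner_add_right]; ring
    have a1 : |‖dirs N hN i + v‖ - ‖dirs N hN i‖| ≤ ‖v‖ := by
      have := abs_norm_sub_norm_le (dirs N hN i + v) (dirs N hN i)
      simpa using this
    have a2 := abs_real_inner_le_norm x v
    have a3 : |(‖dirs N hN i + v‖ - ‖dirs N hN i‖) * t - inner ℝ x v| ≤ Z / (4 * N) := by
      calc _ ≤ |(‖dirs N hN i + v‖ - ‖dirs N hN i‖) * t| + |inner ℝ x v| := abs_sub _ _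
        _ ≤ ‖v‖ * Z + Z * ‖v‖ := by
          rw [abs_mul]
          refine add_le_add ?_ (a2.trans ?_) <;> gcongr
        _ = 2 * Z * ‖v‖ := by ring
        _ ≤ 2 * Z * (1 / (8 * N)) := by gcongr
        _ = _ := by field_simp; ring
    rw [e]
    refine (abs_sub _ _).trans ?_
    rw [hM']
    exact add_le_add (hM i) a3
  have hs : ∀ i : Fin N, |t - x i| ≤ 2/3 * M' := by
    intro i
    have := h1 (some i)
    rw [lt', norm_dirs] at this
    simp only [dirs, EuclideanSpace.inner_single_right] at this
    have e : 3 / 2 * t - 3 / 2 * (starRingEnd ℝ) (x i) = 3/2 * (t - x i) := by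
      simp only [conj_trivial]; ring
    rw [e, abs_mul, abs_of_pos (by norm_num : (0:ℝ) < 3/2)] at this
    linarith
  have hn : |t + x ⟨0, hN⟩| ≤ 2/3 * M' := by
    have := h1 none
    rw [lt', norm_dirs] at this
    simp only [dirs, EuclideanSpace.inner_single_right] at this
    have e : 3 / 2 * t - -(3 / 2) * (starRingEnd ℝ) (x ⟨0, hN⟩) = 3/2 * (t + x ⟨0, hN⟩) := by
      simp only [conj_trivial]; ring
    rw [e, abs_mul, abs_of_pos (by norm_num : (0:ℝ) < 3/2)] at this
    linarith
  have h0 := abs_le.1 (hs ⟨0, hN⟩)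
  have hn' := abs_le.1 hn
  have bt : |t| ≤ 2/3 * M' := abs_le.2 ⟨by linarith, by linarith⟩
  have hM0 : 0 ≤ M' := by linarith [abs_nonneg t]
  have bx : ∀ i, |x i| ≤ 4/3 * M' := fun i => by
    have := abs_le.1 (hs i)
    have := abs_le.1 bt
    exact abs_le.2 ⟨by linarith, by linarith⟩
  have bxn : ‖x‖ ≤ N * (4/3 * M') := by
    have hsum : ‖x‖ ≤ ∑ i, |x i| := by
      have e := (EuclideanSpace.basisFun (Fin N) ℝ).sum_repr x
      calc ‖x‖ = ‖∑ i, (EuclideanSpace.basisFun (Fin N) ℝ).repr x i • (EuclideanSpace.basisFun (Fin N) ℝ) i‖ := by rw [e]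
        _ ≤ ∑ i, ‖(EuclideanSpace.basisFun (Fin N) ℝ).repr x i • (EuclideanSpace.basisFun (Fin N) ℝ) i‖ := norm_sum_le _ _
        _ = _ := by
          refine Finset.sum_congr rfl fun i _ => ?_
          rw [norm_smul]; simp
    refine hsum.trans ((Finset.sum_le_sum fun i _ => bx i).trans (le_of_eq ?_))
    simp
  have hZle : Z ≤ N * (4/3 * M') := by
    rw [hZ, Prod.norm_def]
    refine max_le ?_ bxn
    simp only [Real.norm_eq_abs]
    nlinarith
  have e : N * (4/3 * M') = 4/3 * N * M + Z / 3 := by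
    rw [hM']; field_simp
  rw [e] at hZle
  linarith

noncomputable def Lmap (N : ℕ) (hN : 1 ≤ N) (v : EuclideanSpace ℝ (Fin N)) :
    (ℝ × EuclideanSpace ℝ (Fin N)) →ₗ[ℝ] (Option (Fin N) → ℝ) where
  toFun z i := lt' N (dirs N hN i + v) z
  map_add' z w := by
    ext i; simp only [lt', Prod.fst_add, Prod.snd_add, inner_add_left, Pi.add_apply]; ring
  map_smul' c z := by
    ext i; simp only [lt', Prod.smul_fst, Prod.smul_snd, inner_smul_left, Pi.smul_apply, smul_eq_mul,
      conj_trivial, RingHom.id_apply]; ring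


noncomputable def mdist (N : ℕ) {m : ℕ} (W : Fin m → ℝ × EuclideanSpace ℝ (Fin N))
    (x : ℝ × EuclideanSpace ℝ (Fin N)) (v : EuclideanSpace ℝ (Fin N)) : ℝ≥0∞ :=
  ⨅ j, ENNReal.ofReal |lt' N v x - lt' N v (W j)|

lemma measurable_mdist (N : ℕ) {m : ℕ} (W : Fin m → ℝ × EuclideanSpace ℝ (Fin N)) :
    Measurable fun p : (ℝ × EuclideanSpace ℝ (Fin N)) × EuclideanSpace ℝ (Fin N) =>
      mdist N W p.1 p.2 := by
  unfold mdist lt'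
  refine Measurable.iInf fun j => ?_
  refine ENNReal.measurable_ofReal.comp (Continuous.measurable ?_)
  fun_prop

lemma measurable_mdist' (N : ℕ) {m : ℕ} (W : Fin m → ℝ × EuclideanSpace ℝ (Fin N))
    {Y : Type*} [MeasurableSpace Y] (f : Y → ℝ × EuclideanSpace ℝ (Fin N))
    (g : Y → EuclideanSpace ℝ (Fin N)) (hf : Measurable f) (hg : Measurable g) :
    Measurable fun y => mdist N W (f y) (g y) := by
  have := (measurable_mdist N W).comp (hf.prodMk hg)
  exact this

lemma Gmm_eq (N : ℕ) (hN : 1 ≤ N) {m : ℕ} (W : Fin m → ℝ × EuclideanSpace ℝ (Fin N))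
    (x : ℝ × EuclideanSpace ℝ (Fin N)) (v : EuclideanSpace ℝ (Fin N)) :
    Gmm (Lmap N hN v) W x = ⨆ i, mdist N W x (dirs N hN i + v) := rfl

lemma measurable_Gmm (N : ℕ) (hN : 1 ≤ N) {m : ℕ} (W : Fin m → ℝ × EuclideanSpace ℝ (Fin N)) :
    Measurable fun p : (ℝ × EuclideanSpace ℝ (Fin N)) × EuclideanSpace ℝ (Fin N) =>
      Gmm (Lmap N hN p.2) W p.1 := by
  have e : (fun p : (ℝ × EuclideanSpace ℝ (Fin N)) × EuclideanSpace ℝ (Fin N) =>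
      Gmm (Lmap N hN p.2) W p.1) = fun p => ⨆ i, mdist N W p.1 (dirs N hN i + p.2) :=
    funext fun p => Gmm_eq N hN W p.1 p.2
  rw [e]
  refine Measurable.iSup fun i => ?_
  have h : Measurable fun p : (ℝ × EuclideanSpace ℝ (Fin N)) × EuclideanSpace ℝ (Fin N) =>
      (p.1, dirs N hN i + p.2) :=
    (Continuous.measurable (by fun_prop))
  exact measurable_mdist' N W _ _ measurable_fst (measurable_snd.comp h)

set_option maxHeartbeats 400000 in
lemma per_step (N : ℕ) (hN : 1 ≤ N) (H β a : ℝ) (ha : 0 < a) (hH1 : 1 / 2 ≤ H) (hH2 : H < 1)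
    (hβlow : (N : ℝ) - 2 * H - 1 < β) :
    ∃ c : ℝ, 0 < c ∧ ∀ (n : ℕ) (z : Fin n → ℝ × EuclideanSpace ℝ (Fin N)) (k : Fin n) (b : Fin n → ℝ),
      b k = 1 → (∀ j, k < j → b j = 0) → (∀ i, a ≤ (z i).1) →
      (∀ i j, ‖(z i).2 - (z j).2‖ ≤ a / 4) →
      ∀ zs : ℝ × EuclideanSpace ℝ (Fin N), 
      (∀ i, |(z i).1 - zs.1| + ‖(z i).2 - zs.2‖ ≤ a / 2) →
      ENNReal.ofReal c * ∫⁻ v in Metric.ball (0 : EuclideanSpace ℝ (Fin N)) (1 / (8 * N)), 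
        Gmm (Lmap N hN v) (Fin.cons zs (fun j : Fin k => z (Fin.castLE k.2.le j)) :
          Fin (k + 1) → ℝ × EuclideanSpace ℝ (Fin N)) (z k) ^ (2 * alphaExp N H β) ≤
        ∫⁻ p : ℝ × EuclideanSpace ℝ (Fin N), ENNReal.ofReal
          (‖∑ i, (b i:ℂ) * Gker N (z i).1 (z i).2 p.1 p.2‖^2 * (|p.1|^(1-2*H) * ‖p.2‖^(-β))) := by
  obtain ⟨c, hc, hcb⟩ := var_ge N hN H β a ha hH1 hH2 hβlow
  have hNR : (1:ℝ) ≤ N := by exact_mod_cast hN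
  have hα : 0 < alphaExp N H β := by unfold alphaExp; linarith
  set α := alphaExp N H β with hαdef
  refine ⟨c * (1/2) ^ (2 * α) / (N + 1), by positivity, ?_⟩
  intro n z k b hbk hb hza hzx zs hzs
  set W : Fin (k + 1) → ℝ × EuclideanSpace ℝ (Fin N) :=
    Fin.cons zs (fun j : Fin k => z (Fin.castLE k.2.le j)) with hW
  set R := ∫⁻ p : ℝ × EuclideanSpace ℝ (Fin N), ENNReal.ofReal
          (‖∑ i, (b i:ℂ) * Gker N (z i).1 (z i).2 p.1 p.2‖^2 * (|p.1|^(1-2*H) * ‖p.2‖^(-β))) with hR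
  set δ : ℝ := 1 / (8 * N) with hδ
  have hδ8 : δ ≤ 1 / 8 := by
    rw [hδ]; apply one_div_le_one_div_of_le <;> linarith
  have hfin : ∀ v, mdist N W (z k) v ≠ ∞ := by
    intro v
    refine ne_top_of_le_ne_top ENNReal.ofReal_ne_top (iInf_le _ 0)
  have hle : ∀ v j, (mdist N W (z k) v).toReal ≤ |lt' N v (z k) - lt' N v (W j)| := by
    intro v j
    exact ENNReal.toReal_le_of_le_ofReal (abs_nonneg _) (iInf_le _ j)
  have hmv : Measurable (mdist N W (z k)) := measurable_mdist' N W _ _ measurable_const measurable_id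
  have hmvi : ∀ i, Measurable fun v => mdist N W (z k) (dirs N hN i + v) ^ (2 * α) := by
    intro i
    have h : Measurable fun v : EuclideanSpace ℝ (Fin N) => dirs N hN i + v :=
      Continuous.measurable (by fun_prop)
    exact (measurable_mdist' N W _ _ measurable_const h).pow_const _
  have key : ∀ i, ENNReal.ofReal (c * (1/2) ^ (2 * α)) * ∫⁻ v in Metric.ball (0 : EuclideanSpace ℝ (Fin N)) δ,
      mdist N W (z k) (dirs N hN i + v) ^ (2 * α) ≤ R := by
    intro i
    have hB : ∀ v ∈ Metric.ball (dirs N hN i) δ, 1 ≤ ‖v‖ ∧ ‖v‖ ≤ 2 := by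
      intro v hv
      rw [Metric.mem_ball, dist_eq_norm] at hv
      have h1 := abs_le.1 (abs_norm_sub_norm_le v (dirs N hN i))
      rw [norm_dirs] at h1
      constructor <;> linarith [h1.1, h1.2]
    have := hcb n z k b hbk hb hza hzx (Metric.ball (dirs N hN i) δ) measurableSet_ball hB
      (fun v => 1/2 * (mdist N W (z k) v).toReal) (fun v _ => by positivity)
      (fun v hv => by
        have h1 := hle v 0
        rw [lt'_sub] at h1
        have h2 := abs_lt'_le N v (z k - W 0)
        have h3 := hzs k
        have e : W 0 = zs := by simp [hW]
        rw [e] at h1 h2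
        simp only [Prod.fst_sub, Prod.snd_sub] at h2
        have h4 := (hB v hv).2
        have h5 : 0 ≤ |(z k).1 - zs.1| + ‖(z k).2 - zs.2‖ := by positivity
        nlinarith)
      (fun v hv j hj => by
        have h1 := hle v (Fin.succ ⟨j.1, hj⟩)
        have e : W (Fin.succ ⟨j.1, hj⟩) = z j := by
          simp only [hW, Fin.cons_succ]; rfl
        rw [e, abs_sub_comm] at h1
        linarith)
    refine le_trans (le_of_eq ?_) this
    rw [ENNReal.ofReal_mul hc.le, mul_assoc]
    congr 1
    have hpre : (fun v => dirs N hN i + v) ⁻¹' (Metric.ball (dirs N hN i) δ) = Metric.ball 0 δ := by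
      ext v; simp [dist_eq_norm]
    rw [← (measurePreserving_add_left volume (dirs N hN i)).setLIntegral_comp_preimage_emb
      (measurableEmbedding_addLeft _) _ (Metric.ball (dirs N hN i) δ), hpre, ← lintegral_const_mul]
    · refine lintegral_congr fun v => ?_
      rw [Real.mul_rpow (by norm_num) ENNReal.toReal_nonneg, ENNReal.ofReal_mul (by positivity),
        ENNReal.toReal_rpow, ENNReal.ofReal_toReal]
      exact ENNReal.rpow_ne_top_of_nonneg (by positivity) (hfin _)
    · exact hmvi i
  have hG : ∀ v, Gmm (Lmap N hN v) W (z k) ^ (2 * α) ≤ ∑ i, mdist N W (z k) (dirs N hN i + v) ^ (2 * α) := by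
    intro v
    rw [Gmm_eq]
    obtain ⟨i, hi⟩ := exists_eq_ciSup_of_finite (f := fun i => mdist N W (z k) (dirs N hN i + v))
    rw [← hi]
    exact Finset.single_le_sum (f := fun i => mdist N W (z k) (dirs N hN i + v) ^ (2 * α)) (fun _ _ => zero_le) (Finset.mem_univ i)
  have hcc : c * (1/2) ^ (2 * α) / (N + 1) = (1 / ((N:ℝ) + 1)) * (c * (1/2) ^ (2 * α)) := by ring
  calc _ ≤ ENNReal.ofReal (c * (1/2) ^ (2 * α) / (N + 1)) *
        ∑ i, ∫⁻ v in Metric.ball (0 : EuclideanSpace ℝ (Fin N)) δ,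
          mdist N W (z k) (dirs N hN i + v) ^ (2 * α) := by
          gcongr
          rw [← lintegral_finsetSum]
          · exact lintegral_mono fun v => hG v
          · intro i _
            exact hmvi i
    _ = ENNReal.ofReal (1 / ((N:ℝ) + 1)) * ∑ i, (ENNReal.ofReal (c * (1/2) ^ (2 * α)) * ∫⁻ v in Metric.ball (0 : EuclideanSpace ℝ (Fin N)) δ,
          mdist N W (z k) (dirs N hN i + v) ^ (2 * α)) := by
          rw [hcc, ENNReal.ofReal_mul (by positivity), mul_assoc, Finset.mul_sum]
    _ ≤ ENNReal.ofReal (1 / ((N:ℝ) + 1)) * ∑ i : Option (Fin N), R := by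
          gcongr with i; exact key i
    _ = R := by
          simp only [Finset.sum_const, Finset.card_univ, Fintype.card_option, Fintype.card_fin, nsmul_eq_mul]
          rw [← mul_assoc]
          have : (((N + 1 : ℕ)) : ℝ≥0∞) = ENNReal.ofReal ((N:ℝ) + 1) := by
            rw [← ENNReal.ofReal_natCast]; push_cast; rfl
          rw [this, ← ENNReal.ofReal_mul (by positivity), one_div_mul_cancel (by positivity)]
          simp


lemma rpow_neg_anti {x y : ℝ≥0∞} (h : x ≤ y) {r : ℝ} (hr : 0 ≤ r) : y ^ (-r) ≤ x ^ (-r) := by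
  rw [ENNReal.rpow_neg, ENNReal.rpow_neg]
  exact ENNReal.inv_le_inv.2 (ENNReal.rpow_le_rpow h hr)

/-- the one-step function -/
noncomputable def hstep (N : ℕ) (hN : 1 ≤ N) (κ : ℝ≥0∞) (s : ℝ) (zs : ℝ × EuclideanSpace ℝ (Fin N))
    (m : ℕ) (w : Fin m → ℝ × EuclideanSpace ℝ (Fin N)) (x : ℝ × EuclideanSpace ℝ (Fin N)) : ℝ≥0∞ :=
  κ * ∫⁻ v in Metric.ball (0 : EuclideanSpace ℝ (Fin N)) (1 / (8 * N)),
    Gmm (Lmap N hN v) (Fin.cons zs w : Fin (m + 1) → ℝ × EuclideanSpace ℝ (Fin N)) x ^ (-s)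

lemma measurable_hstep (N : ℕ) (hN : 1 ≤ N) (κ : ℝ≥0∞) (s : ℝ) (zs : ℝ × EuclideanSpace ℝ (Fin N))
    (m : ℕ) (w : Fin m → ℝ × EuclideanSpace ℝ (Fin N)) : Measurable (hstep N hN κ s zs m w) := by
  unfold hstep
  refine Measurable.const_mul ?_ _
  exact Measurable.lintegral_prod_right'
    (f := fun p : (ℝ × EuclideanSpace ℝ (Fin N)) × EuclideanSpace ℝ (Fin N) =>
      Gmm (Lmap N hN p.2) (Fin.cons zs w : Fin (m + 1) → ℝ × EuclideanSpace ℝ (Fin N)) p.1 ^ (-s))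
    ((measurable_Gmm N hN _).pow_const _)

lemma hstep_int (N : ℕ) (hN : 1 ≤ N) (s : ℝ) (hs0 : 0 < s) (hs : s < 1 + N) :
    ∃ C : ℝ, 0 < C ∧ ∀ (κ : ℝ≥0∞) (zs : ℝ × EuclideanSpace ℝ (Fin N))
      (m : ℕ) (w : Fin m → ℝ × EuclideanSpace ℝ (Fin N)) (I : Set (ℝ × EuclideanSpace ℝ (Fin N)))
      (V : ℝ), 0 < V → volume I = ENNReal.ofReal V →
      ∫⁻ x in I, hstep N hN κ s zs m w x ≤
        κ * volume (Metric.ball (0 : EuclideanSpace ℝ (Fin N)) (1 / (8 * N))) *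
          ENNReal.ofReal (C * ((m + 1 : ℕ) : ℝ) ^ s * V ^ (1 - s / (1 + N))) := by
  have : (volume : Measure (ℝ × EuclideanSpace ℝ (Fin N))).IsAddHaarMeasure :=
    Measure.prod.instIsAddHaarMeasure volume volume
  have hfr : Module.finrank ℝ (ℝ × EuclideanSpace ℝ (Fin N)) = 1 + N := by
    rw [Module.finrank_prod]; simp
  have hNR : (1:ℝ) ≤ N := by exact_mod_cast hN
  obtain ⟨C, hC, hCb⟩ := step_int (volume : Measure (ℝ × EuclideanSpace ℝ (Fin N)))
    (Option (Fin N)) (by rw [hfr]; simp [add_comm]) s (2 * N) hs0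
    (by rw [hfr]; push_cast; exact hs) (by linarith)
  refine ⟨C, hC, ?_⟩
  intro κ zs m w I V hV hI
  have hmG := measurable_Gmm N hN (Fin.cons zs w : Fin (m + 1) → ℝ × EuclideanSpace ℝ (Fin N))
  unfold hstep
  rw [lintegral_const_mul, mul_assoc]
  · gcongr
    rw [lintegral_lintegral_swap]
    · calc _ ≤ ∫⁻ v in Metric.ball (0 : EuclideanSpace ℝ (Fin N)) (1 / (8 * N)),
            ENNReal.ofReal (C * ((m + 1 : ℕ) : ℝ) ^ s * V ^ (1 - s / (1 + N))) := by
            refine setLIntegral_mono' measurableSet_ball fun v hv => ?_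
            have hv' : ‖v‖ ≤ 1 / (8 * N) := by
              rw [mem_ball_zero_iff] at hv; exact hv.le
            have := hCb (Lmap N hN v) (fun z M hM => dir_bound N hN v hv' z M hM) (m + 1)
              (Nat.succ_pos _) (Fin.cons zs w) I V hV hI
            rw [hfr] at this
            push_cast at this ⊢
            exact this
        _ = _ := by
            rw [setLIntegral_const, mul_comm]
    · exact (hmG.pow_const (-s)).aemeasurable
  · exact Measurable.lintegral_prod_right'
      (f := fun p : (ℝ × EuclideanSpace ℝ (Fin N)) × EuclideanSpace ℝ (Fin N) =>
        Gmm (Lmap N hN p.2) (Fin.cons zs w : Fin (m + 1) → ℝ × EuclideanSpace ℝ (Fin N)) p.1 ^ (-s))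
      (hmG.pow_const _)

lemma jensen_step (N : ℕ) (hN : 1 ≤ N) (α r c : ℝ) (hr : 0 < r) (hc : 0 < c) :
    ∃ κ : ℝ≥0∞, κ ≠ ∞ ∧ ∀ (zs : ℝ × EuclideanSpace ℝ (Fin N))
      (m : ℕ) (w : Fin m → ℝ × EuclideanSpace ℝ (Fin N)) (x : ℝ × EuclideanSpace ℝ (Fin N)),
      (ENNReal.ofReal c * ∫⁻ v in Metric.ball (0 : EuclideanSpace ℝ (Fin N)) (1 / (8 * N)),
        Gmm (Lmap N hN v) (Fin.cons zs w : Fin (m + 1) → ℝ × EuclideanSpace ℝ (Fin N)) x ^ (2 * α)) ^ (-r)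
      ≤ hstep N hN κ (α * (2 * r)) zs m w x := by
  have hNR : (1:ℝ) ≤ N := by exact_mod_cast hN
  set U := Metric.ball (0 : EuclideanSpace ℝ (Fin N)) (1 / (8 * N)) with hU
  have hU0 : volume U ≠ 0 := (Metric.measure_ball_pos _ _ (by positivity)).ne'
  have hUt : volume U ≠ ∞ := measure_ball_lt_top.ne
  have hU1 : (volume U) ^ (1 + r) ≠ 0 := by
    simp [ENNReal.rpow_eq_zero_iff, hU0, hUt]
  have hU2 : (volume U) ^ (1 + r) ≠ ∞ := ENNReal.rpow_ne_top_of_nonneg (by linarith) hUt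
  have hc0 : ENNReal.ofReal c ≠ 0 := by simp [hc]
  have hc1 : ENNReal.ofReal c ^ (-r) ≠ ∞ := 
    ENNReal.rpow_ne_top_of_nonneg' (pos_iff_ne_zero.2 hc0) ENNReal.ofReal_ne_top
  refine ⟨ENNReal.ofReal c ^ (-r) * ((volume U) ^ (1 + r))⁻¹, 
    ENNReal.mul_ne_top hc1 (ENNReal.inv_ne_top.2 hU1), ?_⟩
  intro zs m w x
  have hmG := (measurable_Gmm N hN (Fin.cons zs w : Fin (m + 1) → ℝ × EuclideanSpace ℝ (Fin N)))
  have hm : Measurable fun v => Gmm (Lmap N hN v)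
    (Fin.cons zs w : Fin (m + 1) → ℝ × EuclideanSpace ℝ (Fin N)) x := by
    have := hmG.comp (measurable_prodMk_left (x := x))
    exact this
  have hj := jensen_neg (volume.restrict U) _ (hm.pow_const (2 * α)) r hr
  rw [Measure.restrict_apply_univ] at hj
  unfold hstep
  rw [← hU]
  simp_rw [← ENNReal.rpow_mul] at hj
  have e : 2 * α * -r = -(α * (2 * r)) := by ring
  rw [e] at hj
  rw [ENNReal.mul_rpow_eq_ite, if_neg (by simp [hc0]), mul_assoc]
  gcongr
  rw [← ENNReal.div_eq_inv_mul, ENNReal.le_div_iff_mul_le (Or.inl hU1) (Or.inl hU2), mul_comm]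
  exact hj


lemma norm_le_box (N : ℕ) (x : EuclideanSpace ℝ (Fin N)) (r : ℝ) (h : ∀ i, |x i| ≤ r) :
    ‖x‖ ≤ N * r := by
  have hsum : ‖x‖ ≤ ∑ i, |x i| := by
    have e := (EuclideanSpace.basisFun (Fin N) ℝ).sum_repr x
    calc ‖x‖ = ‖∑ i, (EuclideanSpace.basisFun (Fin N) ℝ).repr x i • (EuclideanSpace.basisFun (Fin N) ℝ) i‖ := by rw [e]
      _ ≤ ∑ i, ‖(EuclideanSpace.basisFun (Fin N) ℝ).repr x i • (EuclideanSpace.basisFun (Fin N) ℝ) i‖ := norm_sum_le _ _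
      _ = _ := by
        refine Finset.sum_congr rfl fun i _ => ?_
        rw [norm_smul]; simp
  refine hsum.trans ((Finset.sum_le_sum fun i _ => h i).trans (le_of_eq ?_))
  simp

/-- Proposition 4.10(i) in Gram-determinant form: if `αd < 1 + N`, then
`∫_{Iⁿ} [det Γ(z¹, …, zⁿ)]^{−d/2} dz̄ ≤ Cⁿ (n!)^{αd} λ_{1+N}(I)^{n(1 − αd/(1+N))}`
for subintervals `I ⊆ T` with side lengths at most `r₀`; `[det Γ]^{−d/2}` is interpreted
as `+∞` when `det Γ = 0`.  Consequently the moments of the local time of the solution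
satisfy `E[L(v, I)ⁿ] ≤ Cⁿ (n!)^{αd} λ_{1+N}(I)^{n(1 − αd/(1+N))}` uniformly in `v`. -/
theorem local_time_moment_estimate
    (N : ℕ) (hN : 1 ≤ N) (H β : ℝ) (hH1 : 1 / 2 ≤ H) (hH2 : H < 1)
    (hβ0 : 0 < β) (hβN : β < N)
    (hβlow : (N : ℝ) - 2 * H - 1 < β) (hβup : β < (N : ℝ) - 2 * H + 1)
    (hfun : EuclideanSpace ℝ (Fin N) → ℝ) (hmeas : Measurable hfun)
    (c₁ c₂ : ℝ) (hc₁ : 0 < c₁) (hc₁₂ : c₁ ≤ c₂)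
    (hflow : ∀ ξ : EuclideanSpace ℝ (Fin N), ξ ≠ 0 → c₁ * ‖ξ‖ ^ (-β) ≤ hfun ξ)
    (hfup : ∀ ξ : EuclideanSpace ℝ (Fin N), ξ ≠ 0 → hfun ξ ≤ c₂ * ‖ξ‖ ^ (-β))
    (d : ℕ) (hd : 1 ≤ d) (hαd : alphaExp N H β * d < 1 + N)
    (Ta Tb : ℝ) (hTa : 0 < Ta) (Xa Xb : Fin N → ℝ) :
    ∃ C r₀ : ℝ, 0 < C ∧ 0 < r₀ ∧
      ∀ (ia ib : ℝ) (ja jb : Fin N → ℝ),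
        {p : ℝ × EuclideanSpace ℝ (Fin N) |
            p.1 ∈ Icc ia ib ∧ ∀ i, p.2 i ∈ Icc (ja i) (jb i)} ⊆
          {p : ℝ × EuclideanSpace ℝ (Fin N) |
            p.1 ∈ Icc Ta Tb ∧ ∀ i, p.2 i ∈ Icc (Xa i) (Xb i)} →
        ib - ia ≤ r₀ → (∀ i, jb i - ja i ≤ r₀) →
        ∀ n : ℕ, 2 ≤ n →
          (∫⁻ z in Set.univ.pi (fun _ : Fin n =>
              {p : ℝ × EuclideanSpace ℝ (Fin N) |
                p.1 ∈ Icc ia ib ∧ ∀ i, p.2 i ∈ Icc (ja i) (jb i)}),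
            (ENNReal.ofReal (gramMat N H hfun z).det) ^ (-(d : ℝ) / 2)) ≤
            ENNReal.ofReal (C ^ n * (n.factorial : ℝ) ^ (alphaExp N H β * d)) *
              (volume {p : ℝ × EuclideanSpace ℝ (Fin N) |
                  p.1 ∈ Icc ia ib ∧ ∀ i, p.2 i ∈ Icc (ja i) (jb i)}) ^
                ((n : ℝ) * (1 - alphaExp N H β * d / (1 + N))) := by
  have hNR : (1:ℝ) ≤ N := by exact_mod_cast hN
  have hdR : (1:ℝ) ≤ d := by exact_mod_cast hd
  have hα : 0 < alphaExp N H β := by unfold alphaExp; linarith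
  obtain ⟨c, hc, hcb⟩ := per_step N hN H β Ta hTa hH1 hH2 hβlow
  obtain ⟨κ, hκ, hκb⟩ := jensen_step N hN (alphaExp N H β) (d / 2) (c₁ * c) (by positivity) (by positivity)
  have es : alphaExp N H β * (2 * ((d:ℝ) / 2)) = alphaExp N H β * d := by ring
  rw [es] at hκb
  set s := alphaExp N H β * d with hs
  have hs0 : 0 < s := by positivity
  obtain ⟨Cs, hCs, hCsb⟩ := hstep_int N hN s hs0 hαd
  set A : ℝ≥0∞ := κ * volume (Metric.ball (0 : EuclideanSpace ℝ (Fin N)) (1 / (8 * N))) with hA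
  have hAt : A ≠ ∞ := ENNReal.mul_ne_top hκ measure_ball_lt_top.ne
  refine ⟨A.toReal * Cs + 1, Ta / (4 * (N + 1)), by positivity, by positivity, ?_⟩
  intro ia ib ja jb hsub hi hj n hn
  set I : Set (ℝ × EuclideanSpace ℝ (Fin N)) := {p : ℝ × EuclideanSpace ℝ (Fin N) |
                p.1 ∈ Icc ia ib ∧ ∀ i, p.2 i ∈ Icc (ja i) (jb i)} with hI
  set r₀ := Ta / (4 * ((N:ℝ) + 1)) with hr₀
  have hr₀' : (N + 1) * r₀ = Ta / 4 := by rw [hr₀]; field_simp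
  have hr₀p : 0 < r₀ := by positivity
  have mI : MeasurableSet I := by
    refine IsClosed.measurableSet ?_
    have : I = (Prod.fst ⁻¹' Icc ia ib) ∩ ⋂ i, (fun p : ℝ × EuclideanSpace ℝ (Fin N) => p.2 i) ⁻¹' Icc (ja i) (jb i) := by
      ext p; simp [hI]
    rw [this]
    refine (isClosed_Icc.preimage continuous_fst).inter (isClosed_iInter fun i => ?_)
    exact isClosed_Icc.preimage (by fun_prop)
  by_cases hV0 : volume I = 0
  · have : volume (Set.univ.pi (fun _ : Fin n => I)) = 0 := by
      rw [volume_pi_pi]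
      exact Finset.prod_eq_zero (Finset.mem_univ (⟨0, by omega⟩ : Fin n)) hV0
    rw [setLIntegral_measure_zero _ _ this]
    exact zero_le
  obtain ⟨zs, hzs⟩ : I.Nonempty := nonempty_of_measure_ne_zero hV0
  have hdt : ∀ p ∈ I, ∀ q ∈ I, |p.1 - q.1| ≤ r₀ := by
    rintro p ⟨hp, _⟩ q ⟨hq, _⟩
    rw [abs_le]; constructor <;> linarith [hp.1, hp.2, hq.1, hq.2]
  have hdx : ∀ p ∈ I, ∀ q ∈ I, ‖p.2 - q.2‖ ≤ N * r₀ := by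
    rintro p ⟨_, hp⟩ q ⟨_, hq⟩
    refine norm_le_box N _ _ fun i => ?_
    rw [PiLp.sub_apply, abs_le]
    constructor <;> linarith [(hp i).1, (hp i).2, (hq i).1, (hq i).2, hj i]
  have hVt : volume I ≠ ∞ := by
    have hsb : I ⊆ Icc ia ib ×ˢ Metric.closedBall zs.2 (N * r₀) := by
      intro p hp
      exact ⟨hp.1, by rw [Metric.mem_closedBall, dist_eq_norm]; exact hdx p hp zs hzs⟩
    refine ((measure_mono hsb).trans_lt ?_).ne
    rw [Measure.volume_eq_prod, Measure.prod_prod]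
    exact ENNReal.mul_lt_top measure_Icc_lt_top measure_closedBall_lt_top
  set V := (volume I).toReal with hV
  have hVI : volume I = ENNReal.ofReal V := (ENNReal.ofReal_toReal hVt).symm
  have hVp : 0 < V := ENNReal.toReal_pos hV0 hVt
  set e : ℝ := 1 - s / (1 + N) with he
  set M : ℕ → ℝ≥0∞ := fun m => A * ENNReal.ofReal (Cs * ((m + 1 : ℕ) : ℝ) ^ s * V ^ e) with hM
  have step1 : (∫⁻ z in Set.univ.pi (fun _ : Fin n => I),
      (ENNReal.ofReal (gramMat N H hfun z).det) ^ (-(d : ℝ) / 2)) ≤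
      ∫⁻ z in Set.univ.pi (fun _ : Fin n => I),
        ∏ k : Fin n, hstep N hN κ s zs k (fun j : Fin k => z (Fin.castLE k.2.le j)) (z k) := by
    refine setLIntegral_mono' (MeasurableSet.univ_pi fun _ => mI) fun z hz => ?_
    have hz' : ∀ i, z i ∈ I := fun i => hz i (mem_univ i)
    have hza : ∀ i, Ta ≤ (z i).1 := fun i => (hsub (hz' i)).1.1
    have hz0 : ∀ i, 0 ≤ (z i).1 := fun i => hTa.le.trans (hza i)
    have hzx : ∀ i j, ‖(z i).2 - (z j).2‖ ≤ Ta / 4 := fun i j => by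
      have := hdx _ (hz' i) _ (hz' j)
      nlinarith
    have hzz : ∀ i, |(z i).1 - zs.1| + ‖(z i).2 - zs.2‖ ≤ Ta / 2 := fun i => by
      have := hdx _ (hz' i) _ hzs
      have := hdt _ (hz' i) _ hzs
      nlinarith
    set D : Fin n → ℝ≥0∞ := fun k => ENNReal.ofReal (c₁ * c) *
      ∫⁻ v in Metric.ball (0 : EuclideanSpace ℝ (Fin N)) (1 / (8 * N)), 
        Gmm (Lmap N hN v) (Fin.cons zs (fun j : Fin k => z (Fin.castLE k.2.le j)) :
          Fin (k + 1) → ℝ × EuclideanSpace ℝ (Fin N)) (z k) ^ (2 * alphaExp N H β) with hD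
    have hDb : ∀ (k : Fin n) (b : Fin n → ℝ), b k = 1 → (∀ j, k < j → b j = 0) →
        D k ≤ ENNReal.ofReal (∑ i, ∑ j, b i * b j * gramMat N H hfun z i j) := by
      intro k b hbk hb
      refine le_trans ?_ (gram_quad N hN H β hH1 hH2 hβN hβlow hfun hmeas c₁ c₂ hc₁ hflow hfup z hz0 b)
      simp only [hD]
      rw [ENNReal.ofReal_mul hc₁.le, mul_assoc]
      gcongr
      exact hcb n z k b hbk hb hza hzx zs hzz
    have hDt : ∀ k, D k ≠ ∞ := fun k => by
      refine ne_top_of_le_ne_top ENNReal.ofReal_ne_top (hDb k (Pi.single k 1) (by simp) fun j hj => ?_)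
      simp [Pi.single_apply, hj.ne']
    have hdet := det_ge_prod n (gramMat N H hfun z)
      (gram_symm N hN H β hH1 hH2 hβN hβlow hfun hmeas c₁ c₂ hc₁ hflow hfup z hz0) D hDb
    have e1 : (-(d : ℝ) / 2) = -((d:ℝ)/2) := by ring
    rw [e1]
    refine (rpow_neg_anti hdet (by positivity)).trans ?_
    rw [← ENNReal.prod_rpow_of_ne_top (fun i _ => hDt i)]
    refine Finset.prod_le_prod' fun k _ => ?_
    exact hκb zs k _ (z k)
  have step2 : ∫⁻ z in Set.univ.pi (fun _ : Fin n => I),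
        ∏ k : Fin n, hstep N hN κ s zs k (fun j : Fin k => z (Fin.castLE k.2.le j)) (z k) ≤
        ∏ k : Fin n, M k := by
    rw [volume_pi, Measure.restrict_pi_pi]
    refine iter_int (volume.restrict I) (hstep N hN κ s zs) (measurable_hstep N hN κ s zs) M ?_ ?_ n
    · intro m
      exact ENNReal.mul_ne_top hAt ENNReal.ofReal_ne_top
    · intro m w
      exact hCsb κ zs m w I V hVp hVI
  refine (step1.trans step2).trans ?_
  have hMle : ∀ m, M m ≤ ENNReal.ofReal ((A.toReal * Cs + 1) * (((m + 1 : ℕ) : ℝ) ^ s * V ^ e)) := by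
    intro m
    simp only [hM]
    rw [← ENNReal.ofReal_toReal hAt, ← ENNReal.ofReal_mul ENNReal.toReal_nonneg]
    apply ENNReal.ofReal_le_ofReal
    rw [ENNReal.toReal_ofReal ENNReal.toReal_nonneg]
    have : 0 ≤ ((m + 1 : ℕ) : ℝ) ^ s * V ^ e := by positivity
    nlinarith
  refine (Finset.prod_le_prod' fun (k : Fin n) _ => hMle k).trans (le_of_eq ?_)
  rw [Fin.prod_univ_eq_prod_range (fun m => ENNReal.ofReal ((A.toReal * Cs + 1) * (((m + 1 : ℕ) : ℝ) ^ s * V ^ e))) n,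
    ← ENNReal.ofReal_prod_of_nonneg (fun i _ => by positivity), Finset.prod_mul_distrib, Finset.prod_mul_distrib,
    Finset.prod_const, Finset.prod_const, Finset.card_range,
    Real.finsetProd_rpow _ _ (fun i _ => by positivity), ← Nat.cast_prod, Finset.prod_range_add_one_eq_factorial,
    ← mul_assoc, ENNReal.ofReal_mul (by positivity)]
  congr 1
  rw [hVI, ENNReal.ofReal_rpow_of_pos hVp, mul_comm (n:ℝ), Real.rpow_mul hVp.le, Real.rpow_natCast]
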